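/- There exists a factbase F such that the set of (codes of) finite rule sets 𝓡 for which every fair R-derivation from the knowledge base ⟨𝓡,F⟩ is finite is Π⁰₂-hard: there is a total computable function reducing the set of (codes of) Turing machines that halt on every input to this set, i.e., for every Turing machine M one can compute a rule set 𝓡_M such that every fair R-derivation from ⟨𝓡_M,F⟩ is finite if and only if M halts on every input. -/

import Mathlib

namespace ExRules

open scoped Classical

noncomputable section

/-- Terms: constants or variables, each indexed by a natural number. -/
inductive Term where
  | const : ℕ → Term
  | var : ℕ → Term
deriving DecidableEq

/-- An atom: a predicate symbol applied to a list of terms (the arity of the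
predicate is the length of the argument list). -/
structure Atom where
  pred : ℕ
  args : List Term
deriving DecidableEq

/-- A factbase is a finite set of atoms. -/
abbrev FactBase := Finset Atom

/-- A substitution: a map on variables (extended by the identity on constants). -/
abbrev Subst := ℕ → Term

def applyTerm (σ : Subst) : Term → Term
  | .const c => .const c
  | .var v => σ v

def Atom.subst (σ : Subst) (a : Atom) : Atom := ⟨a.pred, a.args.map (applyTerm σ)⟩

def Term.vars : Term → Finset ℕ
  | .const _ => ∅
  | .var v => {v}

def Atom.vars (a : Atom) : Finset ℕ := a.args.foldr (fun t s => t.vars ∪ s) ∅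

def FactBase.vars (F : FactBase) : Finset ℕ := F.sup Atom.vars

/-- The variables occurring in a (possibly infinite) set of atoms. -/
def setVars (S : Set Atom) : Set ℕ := {v | ∃ a ∈ S, v ∈ a.vars}

/-- `σ` is a homomorphism from the atom set `S` to the atom set `S'`. -/
def IsHom (σ : Subst) (S S' : Set Atom) : Prop := ∀ a ∈ S, a.subst σ ∈ S'

/-- A retraction is a homomorphism that is the identity on the common variables. -/
def IsRetraction (σ : Subst) (S S' : Set Atom) : Prop :=
  IsHom σ S S' ∧ ∀ v, v ∈ setVars S → v ∈ setVars S' → σ v = Term.var v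

/-- An existential rule `B → ∃z.H` with nonempty body and head.  The frontier and
the existential variables are determined by the variables shared between body and
head. -/
structure Rule where
  body : Finset Atom
  head : Finset Atom
  body_nonempty : body.Nonempty
  head_nonempty : head.Nonempty

instance : DecidableEq Rule := fun R S =>
  decidable_of_iff (R.body = S.body ∧ R.head = S.head) (by
    constructor
    · rintro ⟨h1, h2⟩
      cases R; cases S; simp_all
    · rintro rfl; exact ⟨rfl, rfl⟩)

/-- The frontier of a rule: the variables shared by body and head. -/
def Rule.frontier (R : Rule) : Finset ℕ := FactBase.vars R.body ∩ FactBase.vars R.head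

/-- The existential variables of a rule: head variables not occurring in the body. -/
def Rule.exVars (R : Rule) : Finset ℕ := FactBase.vars R.head \ FactBase.vars R.body

/-- A rule is Datalog if it has no existential variable. -/
def Rule.IsDatalog (R : Rule) : Prop := R.exVars = ∅

/-- A rule has an atomic head if its head is a single atom. -/
def Rule.IsAtomicHead (R : Rule) : Prop := R.head.card = 1

/-- A rule set is a finite set of existential rules. -/
abbrev RuleSet := Finset Rule

instance : Encodable Term :=
  Encodable.ofEquiv (ℕ ⊕ ℕ)
    { toFun := fun t => match t with | .const c => .inl c | .var v => .inr v
      invFun := fun s => match s with | .inl c => .const c | .inr v => .var v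
      left_inv := by intro t; cases t <;> rfl
      right_inv := by intro s; cases s <;> rfl }

instance : Encodable Atom :=
  Encodable.ofEquiv (ℕ × List Term)
    { toFun := fun a => (a.pred, a.args)
      invFun := fun p => ⟨p.1, p.2⟩
      left_inv := fun _ => rfl
      right_inv := fun _ => rfl }

instance : Encodable Rule :=
  Encodable.ofEquiv {p : Finset Atom × Finset Atom // p.1.Nonempty ∧ p.2.Nonempty}
    { toFun := fun R => ⟨(R.body, R.head), R.body_nonempty, R.head_nonempty⟩
      invFun := fun p => ⟨p.1.1, p.1.2, p.2.1, p.2.2⟩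
      left_inv := fun _ => rfl
      right_inv := fun _ => rfl }

/-- A trigger `(R, π)`: a rule together with a substitution. -/
structure Trigger where
  rule : Rule
  map : Subst

/-- The canonical fresh variable `z_t` associated to a trigger `t` and an
existential variable `z`: it is unique for `z` and (the relevant part of) `t`. -/
def Trigger.freshVar (t : Trigger) (z : ℕ) : ℕ :=
  Nat.pair
    (Encodable.encode (t.rule, ((FactBase.vars t.rule.body).sort (· ≤ ·)).map t.map)) z

/-- The extension `π_R` of the substitution of a trigger, mapping each existential
variable `z` to the fresh variable `z_t`. -/
def Trigger.ext (t : Trigger) : Subst := fun v =>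
  if v ∈ t.rule.exVars then Term.var (t.freshVar v) else t.map v

/-- The output of a trigger: `out(t) = π_R(H)`. -/
def Trigger.out (t : Trigger) : Finset Atom := t.rule.head.image (Atom.subst t.ext)

/-- `t` is a trigger on the factbase `F`: its substitution is a homomorphism from
the body of its rule to `F`. -/
def Trigger.IsOn (t : Trigger) (F : FactBase) : Prop := IsHom t.map ↑t.rule.body ↑F

/-- The chase variants: oblivious, semi-oblivious, restricted, equivalent. -/
inductive Variant where
  | O | SO | R | E

/-- Applicability of a trigger on a factbase, for each chase variant. -/
def Applicable : Variant → Trigger → FactBase → Prop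
  | .O, t, F => ¬ t.out ⊆ F
  | .SO, t, F => ∀ t' : Trigger, t'.rule = t.rule →
      (∀ v ∈ t.rule.frontier, t'.map v = t.map v) → ¬ t'.out ⊆ F
  | .R, t, F => ¬ ∃ σ : Subst, IsRetraction σ ↑(F ∪ t.out) ↑F
  | .E, t, F => ¬ ∃ σ : Subst, IsHom σ ↑(F ∪ t.out) ↑F

/-- An atom set `M` satisfies a rule `B → ∃z.H` if every homomorphism from `B`
to `M` extends to a homomorphism mapping `H` into `M`. -/
def SatisfiesRule (M : Set Atom) (R : Rule) : Prop :=
  ∀ σ : Subst, IsHom σ ↑R.body M →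
    ∃ σ' : Subst, (∀ v ∈ FactBase.vars R.body, σ' v = σ v) ∧ IsHom σ' ↑R.head M

/-- A (finite or infinite) derivation from the knowledge base `⟨𝓡, F⟩`:
`len` is the number of triggers (possibly `⊤`), `fb i` is the `i`-th factbase and,
for `i < len`, `tr i` is the trigger producing `fb (i+1)` from `fb i`. -/
structure Derivation (𝓡 : RuleSet) (F : FactBase) where
  len : ℕ∞
  fb : ℕ → FactBase
  tr : ℕ → Trigger
  fb_zero : fb 0 = F
  rule_mem : ∀ i : ℕ, (i : ℕ∞) < len → (tr i).rule ∈ 𝓡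
  trig_on : ∀ i : ℕ, (i : ℕ∞) < len → (tr i).IsOn (fb i)
  trig_new : ∀ i : ℕ, (i : ℕ∞) < len → ¬ (tr i).out ⊆ fb i
  fb_succ : ∀ i : ℕ, (i : ℕ∞) < len → fb (i + 1) = fb i ∪ (tr i).out
  fb_stall : ∀ i : ℕ, ¬ (i : ℕ∞) < len → fb (i + 1) = fb i

namespace Derivation

variable {𝓡 : RuleSet} {F : FactBase}

/-- An `X`-derivation: every applied trigger is `X`-applicable when applied. -/
def IsX (X : Variant) (D : Derivation 𝓡 F) : Prop :=
  ∀ i : ℕ, (i : ℕ∞) < D.len → Applicable X (D.tr i) (D.fb i)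

/-- Datalog-first: a non-Datalog rule is only applied when all Datalog rules of
the rule set are satisfied. -/
def DatalogFirst (D : Derivation 𝓡 F) : Prop :=
  ∀ i : ℕ, (i : ℕ∞) < D.len → ¬ (D.tr i).rule.IsDatalog →
    ∀ R ∈ 𝓡, R.IsDatalog → SatisfiesRule ↑(D.fb i) R

/-- Fairness: every trigger `X`-applicable on some factbase of the derivation is
eventually not `X`-applicable. -/
def Fair (X : Variant) (D : Derivation 𝓡 F) : Prop :=
  ∀ i : ℕ, (i : ℕ∞) ≤ D.len → ∀ t : Trigger, t.rule ∈ 𝓡 → t.IsOn (D.fb i) →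
    Applicable X t (D.fb i) →
    ∃ j : ℕ, i < j ∧ (j : ℕ∞) ≤ D.len ∧ ¬ Applicable X t (D.fb j)

/-- A derivation is finite if its length is not `⊤`. -/
def Finite (D : Derivation 𝓡 F) : Prop := D.len ≠ ⊤

end Derivation

/-- `CT_X^∀` (non-Datalog-first): every fair `X`-derivation from every KB is finite. -/
def CTall (X : Variant) (𝓡 : RuleSet) : Prop :=
  ∀ F : FactBase, ∀ D : Derivation 𝓡 F, D.IsX X → D.Fair X → D.Finite

/-- `CT_X^∃`: some fair `X`-derivation from every KB is finite. -/
def CTex (X : Variant) (𝓡 : RuleSet) : Prop :=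
  ∀ F : FactBase, ∃ D : Derivation 𝓡 F, D.IsX X ∧ D.Fair X ∧ D.Finite

/-- `CT_{df-X}^∀`: every fair Datalog-first `X`-derivation from every KB is finite. -/
def CTallDF (X : Variant) (𝓡 : RuleSet) : Prop :=
  ∀ F : FactBase, ∀ D : Derivation 𝓡 F, D.IsX X → D.DatalogFirst → D.Fair X → D.Finite

/-- `CT_{df-X}^∃`: some fair Datalog-first `X`-derivation from every KB is finite. -/
def CTexDF (X : Variant) (𝓡 : RuleSet) : Prop :=
  ∀ F : FactBase, ∃ D : Derivation 𝓡 F, D.IsX X ∧ D.DatalogFirst ∧ D.Fair X ∧ D.Finite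

/-! ### Single-piece decomposition -/

/-- Adjacency in the piece graph of a rule: two head atoms sharing an existential
variable. -/
def PieceAdj (R : Rule) (a b : Atom) : Prop :=
  a ∈ R.head ∧ b ∈ R.head ∧ (a.vars ∩ b.vars ∩ R.exVars).Nonempty

/-- The piece (connected component of the piece graph) containing a given head atom. -/
def pieceOf (R : Rule) (a : Atom) : Finset Atom :=
  R.head.filter fun b => Relation.ReflTransGen (PieceAdj R) a b

theorem self_mem_pieceOf {R : Rule} {a : Atom} (h : a ∈ R.head) : a ∈ pieceOf R a := by
  rw [pieceOf, Finset.mem_filter]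
  exact ⟨h, Relation.ReflTransGen.refl⟩

/-- The single-piece decomposition of a rule. -/
def Rule.sp (R : Rule) : Finset Rule :=
  R.head.attach.image fun a =>
    ⟨R.body, pieceOf R a.1, R.body_nonempty, ⟨a.1, self_mem_pieceOf a.2⟩⟩

/-- The single-piece decomposition of a rule set. -/
def spSet (𝓡 : RuleSet) : RuleSet := 𝓡.biUnion Rule.sp

/-! ### Atomic decompositions -/

/-- The predicates occurring in a rule set. -/
def RuleSet.predsF (𝓡 : RuleSet) : Finset ℕ :=
  𝓡.sup fun R => (R.body.image Atom.pred) ∪ (R.head.image Atom.pred)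

/-- A fresh predicate `X_R`, unique for `R` and not occurring in `𝓡`. -/
def freshPred (𝓡 : RuleSet) (R : Rule) : ℕ :=
  (RuleSet.predsF 𝓡).sup id + 1 + Encodable.encode R

/-- The atom `X_R(x, z)` over the fresh predicate, whose arguments are the frontier
variables followed by the existential variables of `R`. -/
def xAtom (𝓡 : RuleSet) (R : Rule) : Atom :=
  ⟨freshPred 𝓡 R,
    ((R.frontier.sort (· ≤ ·)).map Term.var) ++ ((R.exVars.sort (· ≤ ·)).map Term.var)⟩

/-- The one-way atomic decomposition of a rule `R = B → ∃z.H` (relative to `𝓡`):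
the rule `B → ∃z.X_R(x,z)` together with a rule `X_R(x,z) → P(t)` for each head atom. -/
def oneAdRule (𝓡 : RuleSet) (R : Rule) : Finset Rule :=
  insert ⟨R.body, {xAtom 𝓡 R}, R.body_nonempty, Finset.singleton_nonempty _⟩
    (R.head.attach.image fun a =>
      ⟨{xAtom 𝓡 R}, {a.1}, Finset.singleton_nonempty _, Finset.singleton_nonempty _⟩)

/-- The one-way atomic decomposition of a rule set. -/
def oneAd (𝓡 : RuleSet) : RuleSet := 𝓡.biUnion (oneAdRule 𝓡)

/-- The two-way atomic decomposition: `2ad(R) = 1ad(R) ∪ {H[x,z] → X_R(x,z)}`. -/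
def twoAd (𝓡 : RuleSet) : RuleSet :=
  oneAd 𝓡 ∪ 𝓡.image fun R =>
    ⟨R.head, {xAtom 𝓡 R}, R.head_nonempty, Finset.singleton_nonempty _⟩

/-! ### Models, entailment, BDDP -/

/-- `M` is a model of the rule set `𝓡`. -/
def IsModelOfRules (𝓡 : RuleSet) (M : Set Atom) : Prop := ∀ R ∈ 𝓡, SatisfiesRule M R

/-- `M` is a model of the knowledge base `⟨𝓡, F⟩`. -/
def IsModelOfKB (𝓡 : RuleSet) (F : FactBase) (M : Set Atom) : Prop :=
  IsModelOfRules 𝓡 M ∧ ∃ σ : Subst, IsHom σ ↑F M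

/-- `M` is a universal model of `⟨𝓡, F⟩`: a model mapping homomorphically into
every model. -/
def IsUniversalModel (𝓡 : RuleSet) (F : FactBase) (M : Set Atom) : Prop :=
  IsModelOfKB 𝓡 F M ∧ ∀ N : Set Atom, IsModelOfKB 𝓡 F N → ∃ σ : Subst, IsHom σ M N

/-- An atom set entails a Boolean conjunctive query `Q` if `Q` maps
homomorphically into it. -/
def EntailsQ (S : Set Atom) (Q : Finset Atom) : Prop := ∃ σ : Subst, IsHom σ ↑Q S

/-- `⟨𝓡, F⟩ ⊨ Q`: every model of the KB entails `Q`. -/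
def KBEntails (𝓡 : RuleSet) (F : FactBase) (Q : Finset Atom) : Prop :=
  ∀ M : Set Atom, IsModelOfKB 𝓡 F M → EntailsQ M Q

/-- `R(F)`: the minimal atom set including `F` and `out(t)` for every trigger `t`
with rule `R` on `F`. -/
def ruleStep (R : Rule) (S : Set Atom) : Set Atom :=
  S ∪ {a | ∃ t : Trigger, t.rule = R ∧ IsHom t.map ↑R.body S ∧ a ∈ t.out}

/-- `𝓡(F) = ⋃_{R ∈ 𝓡} R(F)` (together with `F`). -/
def setStep (𝓡 : RuleSet) (S : Set Atom) : Set Atom := S ∪ ⋃ R ∈ 𝓡, ruleStep R S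

/-- The breadth-first chase `Ch_i(⟨𝓡, F⟩)`. -/
def ch (𝓡 : RuleSet) (F : FactBase) : ℕ → Set Atom
  | 0 => ↑F
  | i + 1 => setStep 𝓡 (ch 𝓡 F i)

/-- The bounded derivation depth property. -/
def BDDP (𝓡 : RuleSet) : Prop :=
  ∀ Q : Finset Atom, ∃ k : ℕ, ∀ F : FactBase, KBEntails 𝓡 F Q ↔ EntailsQ (ch 𝓡 F k) Q

/-! ### Conservative extensions -/

/-- The restriction of an atom set to the atoms over a given set of predicates. -/
def restrictTo (M : Set Atom) (P : Set ℕ) : Set Atom := {a ∈ M | a.pred ∈ P}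

/-- The terms (domain elements) of an atom set. -/
def termsOf (M : Set Atom) : Set Term := {u | ∃ a ∈ M, u ∈ a.args}

/-- `𝓡'` is a conservative extension of `𝓡`. -/
def ConservativeExt (𝓡 𝓡' : RuleSet) : Prop :=
  (↑(RuleSet.predsF 𝓡) : Set ℕ) ⊆ ↑(RuleSet.predsF 𝓡') ∧
  (∀ M : Set Atom, IsModelOfRules 𝓡' M →
    IsModelOfRules 𝓡 (restrictTo M ↑(RuleSet.predsF 𝓡))) ∧
  (∀ M : Set Atom, IsModelOfRules 𝓡 M →
    ∃ M' : Set Atom, M ⊆ M' ∧ IsModelOfRules 𝓡' M' ∧ termsOf M' = termsOf M ∧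
      restrictTo M' ↑(RuleSet.predsF 𝓡) = restrictTo M ↑(RuleSet.predsF 𝓡))

/-- `𝓡'` is a universal-conservative extension of `𝓡`. -/
def UnivConservativeExt (𝓡 𝓡' : RuleSet) : Prop :=
  (↑(RuleSet.predsF 𝓡) : Set ℕ) ⊆ ↑(RuleSet.predsF 𝓡') ∧
  ∀ F : FactBase, (∀ a ∈ F, a.pred ∈ RuleSet.predsF 𝓡) →
    (∀ M : Set Atom, IsUniversalModel 𝓡' F M →
      IsUniversalModel 𝓡 F (restrictTo M ↑(RuleSet.predsF 𝓡))) ∧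
    (∀ M : Set Atom, IsUniversalModel 𝓡 F M →
      ∃ M' : Set Atom, M ⊆ M' ∧ IsUniversalModel 𝓡' F M' ∧ termsOf M' = termsOf M ∧
        restrictTo M' ↑(RuleSet.predsF 𝓡) = restrictTo M ↑(RuleSet.predsF 𝓡))

/-! ### Substitutions and variables -/

theorem Atom.mem_vars {a : Atom} {v : ℕ} : v ∈ a.vars ↔ Term.var v ∈ a.args := by
  obtain ⟨p, ts⟩ := a
  simp only [Atom.vars]
  induction ts with
  | nil => simp
  | cons t ts ih =>
    rw [List.foldr_cons, Finset.mem_union, ih, List.mem_cons]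
    cases t <;> simp [Term.vars]

theorem FactBase.mem_vars {F : FactBase} {v : ℕ} :
    v ∈ FactBase.vars F ↔ ∃ a ∈ F, Term.var v ∈ a.args := by
  simp [FactBase.vars, Finset.mem_sup, Atom.mem_vars]

theorem mem_setVars_coe {F : FactBase} {v : ℕ} :
    v ∈ setVars (F : Set Atom) ↔ v ∈ FactBase.vars F := by
  simp [setVars, FactBase.mem_vars, Atom.mem_vars]

theorem Atom.subst_var (a : Atom) : a.subst Term.var = a := by
  obtain ⟨p, ts⟩ := a
  have h : applyTerm Term.var = id := by
    funext t
    cases t <;> rfl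
  simp [Atom.subst, h]

theorem Atom.subst_subst (σ τ : Subst) (a : Atom) :
    (a.subst σ).subst τ = a.subst (fun v => applyTerm τ (σ v)) := by
  obtain ⟨p, ts⟩ := a
  simp only [Atom.subst, List.map_map, Atom.mk.injEq, true_and]
  refine List.map_congr_left fun t _ => ?_
  cases t <;> rfl

theorem Atom.subst_congr {σ τ : Subst} {a : Atom}
    (h : ∀ v, Term.var v ∈ a.args → σ v = τ v) : a.subst σ = a.subst τ := by
  obtain ⟨p, ts⟩ := a
  simp only [Atom.subst, Atom.mk.injEq, true_and]
  refine List.map_congr_left fun t ht => ?_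
  cases t with
  | const c => rfl
  | var v => exact h v ht

theorem IsHom.congr {σ τ : Subst} {B : FactBase} {S : Set Atom} (h : IsHom σ ↑B S)
    (hστ : ∀ v ∈ FactBase.vars B, τ v = σ v) : IsHom τ ↑B S := by
  intro a ha
  rw [Atom.subst_congr fun v hv => hστ v (FactBase.mem_vars.2 ⟨a, ha, hv⟩)]
  exact h a ha

theorem IsHom.mono {σ : Subst} {S T T' : Set Atom} (h : IsHom σ S T) (hT : T ⊆ T') :
    IsHom σ S T' := fun a ha => hT (h a ha)

theorem mem_subst_args {σ : Subst} {a : Atom} {v : ℕ} (hv : Term.var v ∈ a.args) :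
    σ v ∈ (a.subst σ).args :=
  List.mem_map.2 ⟨Term.var v, hv, rfl⟩

/-! ### Triggers -/

theorem Rule.mem_exVars {R : Rule} {v : ℕ} :
    v ∈ R.exVars ↔ v ∈ FactBase.vars R.head ∧ v ∉ FactBase.vars R.body := by
  simp [Rule.exVars]

/-- The code of the relevant part of a trigger. -/
def Trigger.code (t : Trigger) : ℕ :=
  Encodable.encode (t.rule, ((FactBase.vars t.rule.body).sort (· ≤ ·)).map t.map)

theorem Trigger.code_eq_iff {t t' : Trigger} :
    t.code = t'.code ↔
      t.rule = t'.rule ∧ ∀ v ∈ FactBase.vars t.rule.body, t.map v = t'.map v := by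
  unfold Trigger.code
  rw [Encodable.encode_inj, Prod.mk.injEq]
  refine and_congr_right fun h => ?_
  rw [← h]
  simp

theorem Trigger.freshVar_eq (t : Trigger) (z : ℕ) : t.freshVar z = Nat.pair t.code z := rfl

theorem Trigger.out_eq_of_code_eq {t t' : Trigger} (h : t.code = t'.code) : t.out = t'.out := by
  obtain ⟨hr, hm⟩ := Trigger.code_eq_iff.1 h
  unfold Trigger.out
  rw [← hr]
  refine Finset.image_congr fun a ha => Atom.subst_congr fun v hv => ?_
  unfold Trigger.ext
  rw [← hr, Trigger.freshVar_eq, Trigger.freshVar_eq, h]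
  split_ifs with hx
  · rfl
  · refine hm v ?_
    by_contra hb
    exact hx (Rule.mem_exVars.2 ⟨FactBase.mem_vars.2 ⟨a, ha, hv⟩, hb⟩)

theorem Trigger.ext_of_mem_body {t : Trigger} {v : ℕ} (hv : v ∈ FactBase.vars t.rule.body) :
    t.ext v = t.map v := by
  unfold Trigger.ext
  rw [if_neg]
  exact fun h => (Rule.mem_exVars.1 h).2 hv

theorem Trigger.IsOn.mono {t : Trigger} {F F' : FactBase} (h : t.IsOn F) (hF : F ⊆ F') :
    t.IsOn F' := IsHom.mono h (by exact_mod_cast hF)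

theorem Trigger.IsOn.map_mem_args {t : Trigger} {F : FactBase} (h : t.IsOn F) {v : ℕ}
    (hv : v ∈ FactBase.vars t.rule.body) : ∃ a ∈ F, t.map v ∈ a.args := by
  obtain ⟨a, ha, hva⟩ := FactBase.mem_vars.1 hv
  exact ⟨a.subst t.map, h a ha, mem_subst_args hva⟩

theorem Trigger.mem_out {t : Trigger} {a : Atom} (ha : a ∈ t.rule.head) :
    a.subst t.ext ∈ t.out := Finset.mem_image_of_mem _ ha

theorem not_applicable_of_out_subset {t : Trigger} {F : FactBase} (h : t.out ⊆ F) :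
    ¬ Applicable .R t F := by
  simp only [Applicable, not_not]
  refine ⟨Term.var, fun a ha => ?_, fun _ _ _ => rfl⟩
  rw [Atom.subst_var]
  rwa [Finset.union_eq_left.2 h] at ha

theorem exists_head_hom_of_not_applicable {t : Trigger} {F : FactBase} (hon : t.IsOn F)
    (h : ¬ Applicable .R t F) :
    ∃ σ : Subst, (∀ v ∈ FactBase.vars t.rule.body, σ v = t.map v) ∧
      IsHom σ ↑t.rule.head ↑F := by
  simp only [Applicable, not_not] at h
  obtain ⟨σ, hhom, hid⟩ := h
  refine ⟨fun v => applyTerm σ (t.ext v), fun v hv => ?_, fun a ha => ?_⟩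
  · beta_reduce
    rw [Trigger.ext_of_mem_body hv]
    obtain ⟨a, ha, hva⟩ := hon.map_mem_args hv
    cases hm : t.map v with
    | const c => rfl
    | var u =>
      rw [hm] at hva
      refine hid u ?_ ?_
      · exact ⟨a, by simp [ha], Atom.mem_vars.2 hva⟩
      · exact ⟨a, by simp [ha], Atom.mem_vars.2 hva⟩
  · rw [← Atom.subst_subst]
    exact hhom _ (by simpa using Or.inr (Trigger.mem_out ha))

/-- Every variable of `F` created by a trigger witnesses that the trigger was applied. -/
def FreshInv (F : FactBase) : Prop :=
  ∀ t : Trigger, ∀ z ∈ t.rule.exVars, t.freshVar z ∈ FactBase.vars F → t.out ⊆ F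

theorem FreshInv.union_out {F : FactBase} (h : FreshInv F) {t : Trigger} (hon : t.IsOn F) :
    FreshInv (F ∪ t.out) := by
  intro t' z hz hv
  obtain ⟨a, ha, hva⟩ := FactBase.mem_vars.1 hv
  rw [Finset.mem_union] at ha
  rcases ha with ha | ha
  · exact (h t' z hz (FactBase.mem_vars.2 ⟨a, ha, hva⟩)).trans Finset.subset_union_left
  · obtain ⟨b, hb, rfl⟩ := Finset.mem_image.1 ha
    obtain ⟨s, hs, hst⟩ := List.mem_map.1 hva
    cases s with
    | const c => simp [applyTerm] at hst
    | var u =>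
      simp only [applyTerm] at hst
      unfold Trigger.ext at hst
      split_ifs at hst with hx
      · rw [Term.var.injEq, Trigger.freshVar_eq, Trigger.freshVar_eq, Nat.pair_eq_pair] at hst
        rw [← Trigger.out_eq_of_code_eq hst.1]
        exact Finset.subset_union_right
      · have hu : u ∈ FactBase.vars t.rule.body := by
          by_contra hb'
          exact hx (Rule.mem_exVars.2 ⟨FactBase.mem_vars.2 ⟨b, hb, hs⟩, hb'⟩)
        obtain ⟨c, hc, huc⟩ := hon.map_mem_args hu
        rw [hst] at huc
        exact (h t' z hz (FactBase.mem_vars.2 ⟨c, hc, huc⟩)).trans Finset.subset_union_left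

theorem freshInv_of_vars_eq_empty {F : FactBase} (h : FactBase.vars F = ∅) : FreshInv F := by
  intro t z _ hv
  simp [h] at hv

/-- A homomorphism to a set satisfying the rule of a trigger extends to the output
of the trigger. -/
theorem FreshInv.exists_hom_extension {F : FactBase} (hF : FreshInv F) {t : Trigger}
    (hon : t.IsOn F) {N : Set Atom} (hN : SatisfiesRule N t.rule) {h : Subst}
    (hh : IsHom h ↑F N) :
    ∃ h' : Subst, (∀ v ∈ FactBase.vars F, h' v = h v) ∧ IsHom h' ↑(F ∪ t.out) N := by
  by_cases hout : t.out ⊆ F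
  · refine ⟨h, fun _ _ => rfl, ?_⟩
    rwa [Finset.union_eq_left.2 hout]
  have hfresh : ∀ z ∈ t.rule.exVars, t.freshVar z ∉ FactBase.vars F := fun z hz hv =>
    hout (hF t z hz hv)
  obtain ⟨σ, hσ, hhead⟩ := hN (fun v => applyTerm h (t.map v)) (fun a ha => by
    rw [← Atom.subst_subst]
    exact hh _ (hon a ha))
  let h' : Subst := fun v => if v ∈ FactBase.vars F then h v else σ v.unpair.2
  have hh' : ∀ v ∈ FactBase.vars F, h' v = h v := fun v hv => if_pos hv
  refine ⟨h', hh', fun a ha => ?_⟩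
  rw [Finset.coe_union, Set.mem_union, Finset.mem_coe, Finset.mem_coe] at ha
  rcases ha with ha | ha
  · exact IsHom.congr hh hh' a ha
  · obtain ⟨b, hb, rfl⟩ := Finset.mem_image.1 ha
    rw [Atom.subst_subst, Atom.subst_congr (τ := σ)]
    · exact hhead b hb
    · intro v hv
      by_cases hx : v ∈ t.rule.exVars
      · have : t.ext v = Term.var (t.freshVar v) := if_pos hx
        rw [this]
        change h' _ = _
        simp only [h']
        rw [if_neg (hfresh v hx), Trigger.freshVar_eq, Nat.unpair_pair]
      · have hu : v ∈ FactBase.vars t.rule.body := by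
          by_contra hb'
          exact hx (Rule.mem_exVars.2 ⟨FactBase.mem_vars.2 ⟨b, hb, hv⟩, hb'⟩)
        rw [Trigger.ext_of_mem_body hu, hσ v hu]
        obtain ⟨c, hc, huc⟩ := hon.map_mem_args hu
        cases hm : t.map v with
        | const k => rfl
        | var u =>
          rw [hm] at huc
          exact hh' u (FactBase.mem_vars.2 ⟨c, hc, huc⟩)

theorem FreshInv.not_applicable {F : FactBase} (hF : FreshInv F) {t : Trigger}
    (hon : t.IsOn F) {σ : Subst} (hσ : ∀ v ∈ FactBase.vars t.rule.body, σ v = t.map v)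
    (hhead : IsHom σ ↑t.rule.head ↑F) : ¬ Applicable .R t F := by
  by_cases hout : t.out ⊆ F
  · exact not_applicable_of_out_subset hout
  have hfresh : ∀ z ∈ t.rule.exVars, t.freshVar z ∉ FactBase.vars F := fun z hz hv =>
    hout (hF t z hz hv)
  simp only [Applicable, not_not]
  let τ : Subst := fun v => if v ∈ FactBase.vars F then Term.var v else σ v.unpair.2
  have hτ : ∀ v ∈ FactBase.vars F, τ v = Term.var v := fun v hv => if_pos hv
  refine ⟨τ, fun a ha => ?_, fun v _ hv => hτ v (mem_setVars_coe.1 hv)⟩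
  rw [Finset.coe_union, Set.mem_union, Finset.mem_coe, Finset.mem_coe] at ha
  rcases ha with ha | ha
  · rw [Atom.subst_congr fun v hv => hτ v (FactBase.mem_vars.2 ⟨a, ha, hv⟩), Atom.subst_var]
    exact ha
  · obtain ⟨b, hb, rfl⟩ := Finset.mem_image.1 ha
    rw [Atom.subst_subst, Atom.subst_congr (τ := σ)]
    · exact hhead b hb
    · intro v hv
      by_cases hx : v ∈ t.rule.exVars
      · have : t.ext v = Term.var (t.freshVar v) := if_pos hx
        rw [this]
        change τ _ = _
        simp only [τ]
        rw [if_neg (hfresh v hx), Trigger.freshVar_eq, Nat.unpair_pair]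
      · have hu : v ∈ FactBase.vars t.rule.body := by
          by_contra hb'
          exact hx (Rule.mem_exVars.2 ⟨FactBase.mem_vars.2 ⟨b, hb, hv⟩, hb'⟩)
        rw [Trigger.ext_of_mem_body hu, hσ v hu]
        obtain ⟨c, hc, huc⟩ := hon.map_mem_args hu
        cases hm : t.map v with
        | const k => rfl
        | var u =>
          rw [hm] at huc
          exact hτ u (FactBase.mem_vars.2 ⟨c, hc, huc⟩)

/-! ### Derivations -/

namespace Derivation

variable {𝓡 : RuleSet} {F : FactBase}

theorem fb_subset_succ (D : Derivation 𝓡 F) (i : ℕ) : D.fb i ⊆ D.fb (i + 1) := by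
  by_cases h : (i : ℕ∞) < D.len
  · rw [D.fb_succ i h]
    exact Finset.subset_union_left
  · rw [D.fb_stall i h]

theorem fb_mono (D : Derivation 𝓡 F) : Monotone D.fb :=
  monotone_nat_of_le_succ D.fb_subset_succ

/-- A property of factbases preserved by triggers holds along a derivation. -/
theorem invariant (D : Derivation 𝓡 F) {P : FactBase → Prop} (h0 : P F)
    (hs : ∀ (E : FactBase) (t : Trigger), P E → t.rule ∈ 𝓡 → t.IsOn E → P (E ∪ t.out)) (i : ℕ) :
    P (D.fb i) := by
  induction i with
  | zero => rwa [D.fb_zero]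
  | succ i ih =>
    by_cases h : (i : ℕ∞) < D.len
    · rw [D.fb_succ i h]
      exact hs _ _ ih (D.rule_mem i h) (D.trig_on i h)
    · rwa [D.fb_stall i h]

/-- The union of the factbases of a derivation. -/
def limit (D : Derivation 𝓡 F) : Set Atom := {a | ∃ i, a ∈ D.fb i}

theorem fb_subset_limit (D : Derivation 𝓡 F) (i : ℕ) : (D.fb i : Set Atom) ⊆ D.limit :=
  fun _ ha => ⟨i, ha⟩

theorem exists_subset_fb (D : Derivation 𝓡 F) (B : Finset Atom) (hB : (B : Set Atom) ⊆ D.limit) :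
    ∃ i, B ⊆ D.fb i := by
  induction B using Finset.induction_on with
  | empty => exact ⟨0, Finset.empty_subset _⟩
  | insert a B _ ih =>
    rw [Finset.coe_insert, Set.insert_subset_iff] at hB
    obtain ⟨⟨i, hi⟩, hB⟩ := hB
    obtain ⟨j, hj⟩ := ih hB
    exact ⟨max i j, Finset.insert_subset (D.fb_mono (le_max_left i j) hi)
      (hj.trans (D.fb_mono (le_max_right i j)))⟩

theorem limit_isModelOfRules (D : Derivation 𝓡 F) (hfair : D.Fair .R) (hlen : D.len = ⊤) :
    IsModelOfRules 𝓡 D.limit := by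
  intro R hR σ hσ
  obtain ⟨i, hi⟩ := D.exists_subset_fb (R.body.image (Atom.subst σ)) (by
    intro a ha
    obtain ⟨b, hb, rfl⟩ := Finset.mem_image.1 (Finset.mem_coe.1 ha)
    exact hσ b hb)
  have hon : ∀ j, i ≤ j → (Trigger.mk R σ).IsOn (D.fb j) := fun j hj a ha =>
    D.fb_mono hj (hi (Finset.mem_image_of_mem _ ha))
  obtain ⟨j, hij, hj⟩ : ∃ j, i ≤ j ∧ ¬ Applicable .R ⟨R, σ⟩ (D.fb j) := by
    by_cases h : Applicable .R ⟨R, σ⟩ (D.fb i)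
    · obtain ⟨j, hij, -, hj⟩ := hfair i (by simp [hlen]) ⟨R, σ⟩ hR (hon i le_rfl) h
      exact ⟨j, hij.le, hj⟩
    · exact ⟨i, le_rfl, h⟩
  obtain ⟨τ, h1, h2⟩ := exists_head_hom_of_not_applicable (hon j hij) hj
  exact ⟨τ, h1, h2.mono (D.fb_subset_limit j)⟩

end Derivation

/-- The trigger `t` can be applied on `F` in an R-derivation over `𝓡`. -/
def Active (𝓡 : RuleSet) (F : FactBase) (t : Trigger) : Prop :=
  t.rule ∈ 𝓡 ∧ t.IsOn F ∧ Applicable .R t F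

/-- An active trigger of least code (arbitrary if there is none). -/
def leastActive (𝓡 : RuleSet) (F : FactBase) : Trigger :=
  if h : ∃ t, Active 𝓡 F t then
    Function.argminOn Trigger.code {t | Active 𝓡 F t} h
  else ⟨⟨{⟨0, []⟩}, {⟨0, []⟩}, by simp, by simp⟩, Term.var⟩

theorem leastActive_active {𝓡 : RuleSet} {F : FactBase} (h : ∃ t, Active 𝓡 F t) :
    Active 𝓡 F (leastActive 𝓡 F) := by
  rw [leastActive, dif_pos h]
  exact Function.argminOn_mem Trigger.code {t | Active 𝓡 F t} h

theorem leastActive_code_le {𝓡 : RuleSet} {F : FactBase} {t : Trigger} (ht : Active 𝓡 F t) :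
    (leastActive 𝓡 F).code ≤ t.code := by
  have h : ∃ t, Active 𝓡 F t := ⟨t, ht⟩
  rw [leastActive, dif_pos h]
  exact Function.argminOn_le Trigger.code {t | Active 𝓡 F t} ht

/-- The factbases obtained by applying first the triggers `ptr 0, …, ptr (n - 1)` and then
always an active trigger of least code. -/
def greedyFb (𝓡 : RuleSet) (F : FactBase) (n : ℕ) (ptr : ℕ → Trigger) : ℕ → FactBase
  | 0 => F
  | i + 1 => greedyFb 𝓡 F n ptr i ∪
      (if i < n then ptr i else leastActive 𝓡 (greedyFb 𝓡 F n ptr i)).out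

/-- If active triggers never run out after the triggers `ptr 0, …, ptr (n - 1)`, then these
start an infinite fair R-derivation. -/
theorem exists_infinite_fair {𝓡 : RuleSet} (n : ℕ) (pre : ℕ → FactBase) (ptr : ℕ → Trigger)
    (hactive : ∀ i < n, Active 𝓡 (pre i) (ptr i))
    (hsucc : ∀ i < n, pre (i + 1) = pre i ∪ (ptr i).out)
    (Inv : FactBase → Prop) (hInv : Inv (pre n))
    (hex : ∀ E, Inv E → ∃ t, Active 𝓡 E t)
    (hpres : ∀ E t, Inv E → Active 𝓡 E t → Inv (E ∪ t.out)) :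
    ∃ D : Derivation 𝓡 (pre 0), D.IsX .R ∧ D.Fair .R ∧ ¬ D.Finite := by
  set fb := greedyFb 𝓡 (pre 0) n ptr with hfb
  set tr : ℕ → Trigger := fun i => if i < n then ptr i else leastActive 𝓡 (fb i) with htr
  have hstep : ∀ i, fb (i + 1) = fb i ∪ (tr i).out := fun i => rfl
  have hpre : ∀ i ≤ n, fb i = pre i := by
    intro i hi
    induction i with
    | zero => rfl
    | succ i ih =>
      rw [hstep, ih (by omega), hsucc i (by omega), htr]
      simp only [if_pos (show i < n by omega)]
  have hinv : ∀ m, Inv (fb (n + m)) := by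
    intro m
    induction m with
    | zero => rw [Nat.add_zero, hpre n le_rfl]; exact hInv
    | succ m ih =>
      rw [← Nat.add_assoc, hstep, htr]
      simp only [if_neg (show ¬ n + m < n by omega)]
      exact hpres _ _ ih (leastActive_active (hex _ ih))
  have hact : ∀ i, Active 𝓡 (fb i) (tr i) := by
    intro i
    by_cases hi : i < n
    · rw [hpre i hi.le, htr]
      simp only [if_pos hi]
      exact hactive i hi
    · rw [htr]
      simp only [if_neg hi]
      obtain ⟨m, rfl⟩ := Nat.exists_eq_add_of_le (not_lt.1 hi)
      exact leastActive_active (hex _ (hinv m))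
  have hmono : Monotone fb := monotone_nat_of_le_succ fun i => by
    rw [hstep]
    exact Finset.subset_union_left
  have hinj : ∀ i j, i < j → (tr i).code ≠ (tr j).code := by
    intro i j hij hc
    refine not_applicable_of_out_subset ?_ (hact j).2.2
    rw [← Trigger.out_eq_of_code_eq hc]
    refine subset_trans ?_ (hmono (Nat.succ_le_of_lt hij))
    rw [Nat.succ_eq_add_one, hstep]
    exact Finset.subset_union_right
  let D : Derivation 𝓡 (pre 0) :=
    { len := ⊤
      fb := fb
      tr := tr
      fb_zero := rfl
      rule_mem := fun i _ => (hact i).1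
      trig_on := fun i _ => (hact i).2.1
      trig_new := fun i _ h => not_applicable_of_out_subset h (hact i).2.2
      fb_succ := fun i _ => hstep i
      fb_stall := fun i h => absurd (ENat.natCast_lt_top i) h }
  refine ⟨D, fun i _ => (hact i).2.2, fun i _ t htR hton htapp => ?_, fun h => h rfl⟩
  by_contra hcon
  push Not at hcon
  have hbound : ∀ m, (tr (n + i + m)).code ≤ t.code := by
    intro m
    rw [htr]
    simp only [if_neg (show ¬ n + i + m < n by omega)]
    refine leastActive_code_le ⟨htR, hton.mono (hmono (by omega)), ?_⟩
    rcases Nat.eq_or_lt_of_le (show i ≤ n + i + m by omega) with h | h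
    · rw [← h]
      exact htapp
    · exact hcon _ h le_top
  have hinj' : Function.Injective fun m => (tr (n + i + m)).code := by
    intro a b hab
    by_contra hne
    rcases Nat.lt_or_gt_of_ne hne with h | h
    · exact hinj (n + i + a) (n + i + b) (by omega) hab
    · exact hinj (n + i + b) (n + i + a) (by omega) hab.symm
  exact Set.infinite_of_injective_forall_mem hinj' (fun m => Set.mem_Iic.2 (hbound m))
    (Set.finite_Iic t.code)

/-! ### Horn clauses over the natural numbers -/

/-- A numeric atom: a predicate applied to numeric terms, where `none` denotes zero and
`some i` denotes the `i`-th variable. -/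
abbrev NumAtom := ℕ × List (Option ℕ)

/-- The value of a numeric term under an assignment. -/
def numVal (ρ : ℕ → ℕ) : Option ℕ → ℕ
  | none => 0
  | some i => ρ i

/-- A Horn clause over the natural numbers. -/
structure Clause where
  body : List NumAtom
  head : NumAtom

/-- An interpretation of the predicates over the natural numbers satisfies a clause. -/
def Clause.Sat (I : ℕ → List ℕ → Prop) (C : Clause) : Prop :=
  ∀ ρ : ℕ → ℕ, (∀ b ∈ C.body, I b.1 (b.2.map (numVal ρ))) → I C.head.1 (C.head.2.map (numVal ρ))

/-- Every variable of the head occurs in the body. -/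
def Clause.Safe (C : Clause) : Prop :=
  ∀ i, some i ∈ C.head.2 → ∃ b ∈ C.body, some i ∈ b.2

/-- Elements of a chain. -/
abbrev predReal : ℕ := 0
/-- Edges of a chain, including those to the brake. -/
abbrev predEdge : ℕ := 1
/-- Successor in a chain. -/
abbrev predSucc : ℕ := 2
/-- Correspondence between the spine and a chain. -/
abbrev predMatch : ℕ := 3
/-- Strict order of a chain. -/
abbrev predLt : ℕ := 4
/-- The graph of the pairing function. -/
abbrev predPair : ℕ := 5
/-- The number of the simulated program. -/
abbrev predProg : ℕ := 6
/-- The graph of the partial function computed by a code. -/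
abbrev predEval (c : Nat.Partrec.Code) : ℕ := 7 + Encodable.encode c

/-- The clauses defining order and pairing. -/
def arithClauses : List Clause :=
  [⟨[(predSucc, [some 0, some 1])], (predLt, [some 0, some 1])⟩,
   ⟨[(predLt, [some 0, some 1]), (predSucc, [some 1, some 2])], (predLt, [some 0, some 2])⟩,
   ⟨[], (predPair, [none, none, none])⟩,
   ⟨[(predPair, [some 0, some 1, some 2]), (predSucc, [some 0, some 3]),
      (predLt, [some 3, some 1]), (predSucc, [some 2, some 4])],
      (predPair, [some 3, some 1, some 4])⟩,
   ⟨[(predPair, [some 0, some 1, some 2]), (predSucc, [some 0, some 1]),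
      (predSucc, [some 2, some 4])], (predPair, [some 1, none, some 4])⟩,
   ⟨[(predPair, [some 0, some 1, some 2]), (predLt, [some 1, some 0]),
      (predSucc, [some 1, some 3]), (predSucc, [some 2, some 4])],
      (predPair, [some 0, some 3, some 4])⟩,
   ⟨[(predPair, [some 0, some 0, some 2]), (predSucc, [some 0, some 3]),
      (predSucc, [some 2, some 4])], (predPair, [none, some 3, some 4])⟩]

open Nat.Partrec (Code) in
/-- The clauses defining the graph of the partial function computed by a code. -/
def codeClauses : Code → List Clause
  | Code.zero => [⟨[(predReal, [some 0])], (predEval .zero, [some 0, none])⟩]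
  | Code.succ => [⟨[(predSucc, [some 0, some 1])], (predEval .succ, [some 0, some 1])⟩]
  | Code.left =>
    [⟨[(predPair, [some 0, some 1, some 2])], (predEval .left, [some 2, some 0])⟩]
  | Code.right =>
    [⟨[(predPair, [some 0, some 1, some 2])], (predEval .right, [some 2, some 1])⟩]
  | Code.pair f g =>
    ⟨[(predEval f, [some 0, some 1]), (predEval g, [some 0, some 2]),
      (predPair, [some 1, some 2, some 3])], (predEval (.pair f g), [some 0, some 3])⟩ ::
      (codeClauses f ++ codeClauses g)
  | Code.comp f g =>
    ⟨[(predEval g, [some 0, some 1]), (predEval f, [some 1, some 2])],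
      (predEval (.comp f g), [some 0, some 2])⟩ ::
      (codeClauses f ++ codeClauses g)
  | Code.prec f g =>
    ⟨[(predEval f, [some 0, some 1]), (predPair, [some 0, none, some 2])],
      (predEval (.prec f g), [some 2, some 1])⟩ ::
    ⟨[(predPair, [some 0, some 1, some 2]), (predEval (.prec f g), [some 2, some 3]),
      (predPair, [some 1, some 3, some 4]), (predPair, [some 0, some 4, some 5]),
      (predEval g, [some 5, some 6]), (predSucc, [some 1, some 7]),
      (predPair, [some 0, some 7, some 8])],
      (predEval (.prec f g), [some 8, some 6])⟩ ::
      (codeClauses f ++ codeClauses g)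
  | Code.rfind' f =>
    ⟨[(predPair, [some 0, some 1, some 2]), (predEval f, [some 2, none])],
      (predEval (.rfind' f), [some 2, some 1])⟩ ::
    ⟨[(predPair, [some 0, some 1, some 2]), (predEval f, [some 2, some 3]),
      (predSucc, [some 4, some 3]), (predSucc, [some 1, some 5]),
      (predPair, [some 0, some 5, some 6]), (predEval (.rfind' f), [some 6, some 7])],
      (predEval (.rfind' f), [some 2, some 7])⟩ ::
      codeClauses f

/-- The clause stating that the number of the simulated program is `e + 1`. -/
def progClause (e : ℕ) : Clause :=
  ⟨(predSucc, [none, some 0]) ::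
    (List.range e).map fun i => (predSucc, [some i, some (i + 1)]), (predProg, [some e])⟩

/-- The intended interpretation of the numeric predicates. -/
def Holds (e p : ℕ) (ks : List ℕ) : Prop :=
  (p = predReal → ∃ k, ks = [k]) ∧
  (p = predSucc → ∃ k, ks = [k, k + 1]) ∧
  (p = predLt → ∃ a b, ks = [a, b] ∧ a < b) ∧
  (p = predPair → ∃ a b, ks = [a, b, Nat.pair a b]) ∧
  (p = predProg → ks = [e + 1]) ∧
  (∀ c : Nat.Partrec.Code, p = predEval c → ∃ a b, ks = [a, b] ∧ b ∈ c.eval a)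

section Holds

variable {e a b c : ℕ}

theorem predEval_ne {p : ℕ} (hp : p < 7) (c : Nat.Partrec.Code) : p ≠ predEval c := by
  unfold predEval
  omega

@[simp] theorem holds_real : Holds e predReal [a] := by
  simp [Holds, (predEval_ne (show 0 < 7 by omega) _)]

@[simp] theorem holds_succ : Holds e predSucc [a, b] ↔ b = a + 1 := by
  simp [Holds, (predEval_ne (show 2 < 7 by omega) _)]

@[simp] theorem holds_lt : Holds e predLt [a, b] ↔ a < b := by
  simp [Holds, (predEval_ne (show 4 < 7 by omega) _)]

@[simp] theorem holds_pair : Holds e predPair [a, b, c] ↔ c = Nat.pair a b := by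
  simp [Holds, (predEval_ne (show 5 < 7 by omega) _)]

@[simp] theorem holds_prog : Holds e predProg [a] ↔ a = e + 1 := by
  simp [Holds, (predEval_ne (show 6 < 7 by omega) _)]

@[simp] theorem holds_eval {f : Nat.Partrec.Code} : Holds e (predEval f) [a, b] ↔ b ∈ f.eval a := by
  have h : ∀ p < 7, predEval f ≠ p := fun p hp => (predEval_ne hp f).symm
  simp only [Holds, h 0 (by omega), h 2 (by omega), h 4 (by omega), h 5 (by omega),
    h 6 (by omega), false_imp_iff, true_and, predEval, Nat.add_left_cancel_iff,
    Encodable.encode_inj]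
  simp

end Holds

theorem Nat.pair_succ_left_of_lt {a b : ℕ} (h : a + 1 < b) :
    Nat.pair (a + 1) b = Nat.pair a b + 1 := by
  simp only [Nat.pair, if_pos h, if_pos (show a < b by omega)]
  omega

theorem Nat.pair_succ_zero (a : ℕ) : Nat.pair (a + 1) 0 = Nat.pair a (a + 1) + 1 := by
  simp only [Nat.pair]
  simp
  ring

theorem Nat.pair_succ_right_of_lt {a b : ℕ} (h : b < a) :
    Nat.pair a (b + 1) = Nat.pair a b + 1 := by
  simp only [Nat.pair, if_neg (show ¬ a < b + 1 by omega), if_neg (show ¬ a < b by omega)]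
  omega

theorem Nat.pair_zero_succ (a : ℕ) : Nat.pair 0 (a + 1) = Nat.pair a a + 1 := by
  simp only [Nat.pair]
  simp
  ring

theorem arithClauses_sat (e : ℕ) : ∀ C ∈ arithClauses, C.Sat (Holds e) := by
  simp only [arithClauses, List.forall_mem_cons, Clause.Sat, List.map_cons, List.map_nil, numVal,
    holds_succ, holds_lt, holds_pair]
  simp only [List.not_mem_nil, false_imp_iff, implies_true, and_true]
  refine ⟨?_, ?_, ?_, ?_, ?_, ?_, ?_⟩
  · intro ρ h
    omega
  · intro ρ h
    omega
  · exact fun _ _ => rfl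
  · rintro ρ ⟨h1, h2, h3, h4⟩
    rw [h2] at h3 ⊢
    rw [Nat.pair_succ_left_of_lt h3, h4, h1]
  · rintro ρ ⟨h1, h2, h3⟩
    rw [h3, h1, h2, Nat.pair_succ_zero]
  · rintro ρ ⟨h1, h2, h3, h4⟩
    rw [h3, Nat.pair_succ_right_of_lt h2, h4, h1]
  · rintro ρ ⟨h1, h2, h3⟩
    rw [h3, h2, h1, Nat.pair_zero_succ]

theorem mem_eval_rfind'_iff_exists {f : Nat.Partrec.Code} {a m k : ℕ} :
    k ∈ (Nat.Partrec.Code.rfind' f).eval (Nat.pair a m) ↔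
      ∃ n, (0 ∈ f.eval (Nat.pair a (n + m)) ∧
        ∀ j < n, ∃ v ∈ f.eval (Nat.pair a (j + m)), v ≠ 0) ∧ n + m = k := by
  change k ∈ Nat.unpaired (fun a m => (Nat.rfind fun n =>
    (f.eval (Nat.pair a (n + m))).map fun x => decide (x = 0)).map (· + m)) (Nat.pair a m) ↔ _
  simp only [Nat.unpaired, Nat.unpair_pair, Part.mem_map_iff]
  refine exists_congr fun n => and_congr_left fun _ => Nat.mem_rfind.trans ?_
  simp

/-- The unbounded search of `rfind'` either stops immediately or moves on. -/
theorem mem_eval_rfind' {f : Nat.Partrec.Code} {a m k : ℕ} :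
    k ∈ (Nat.Partrec.Code.rfind' f).eval (Nat.pair a m) ↔
      (0 ∈ f.eval (Nat.pair a m) ∧ k = m) ∨
      (∃ v, v + 1 ∈ f.eval (Nat.pair a m)) ∧
        k ∈ (Nat.Partrec.Code.rfind' f).eval (Nat.pair a (m + 1)) := by
  simp only [mem_eval_rfind'_iff_exists]
  constructor
  · rintro ⟨n, ⟨h1, h2⟩, rfl⟩
    cases n with
    | zero => exact Or.inl ⟨by simpa using h1, by simp⟩
    | succ n =>
      refine Or.inr ⟨?_, n, ⟨?_, fun j hj => ?_⟩, by omega⟩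
      · obtain ⟨v, hv, hv0⟩ := h2 0 (Nat.succ_pos n)
        obtain ⟨w, rfl⟩ := Nat.exists_eq_succ_of_ne_zero hv0
        exact ⟨w, by simpa using hv⟩
      · rwa [show n + (m + 1) = n + 1 + m by omega]
      · rw [show j + (m + 1) = j + 1 + m by omega]
        exact h2 _ (by omega)
  · rintro (⟨h, rfl⟩ | ⟨⟨v, hv⟩, n, ⟨h1, h2⟩, rfl⟩)
    · exact ⟨0, ⟨by simpa using h, fun j hj => by omega⟩, by simp⟩
    · refine ⟨n + 1, ⟨?_, fun j hj => ?_⟩, by omega⟩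
      · rwa [show n + 1 + m = n + (m + 1) by omega]
      · cases j with
        | zero => exact ⟨v + 1, by simpa using hv, by omega⟩
        | succ j =>
          rw [show j + 1 + m = j + (m + 1) by omega]
          exact h2 _ (by omega)

theorem codeClauses_sat (e : ℕ) (c : Nat.Partrec.Code) :
    ∀ C ∈ codeClauses c, C.Sat (Holds e) := by
  induction c with
  | zero =>
    simp [codeClauses, Clause.Sat, numVal, Nat.Partrec.Code.eval, Pure.pure, PFun.pure]
  | succ => simp [codeClauses, Clause.Sat, numVal, Nat.Partrec.Code.eval]
  | left =>
    simp only [codeClauses, List.forall_mem_cons, Clause.Sat, List.map_cons, List.map_nil, numVal,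
      holds_eval, holds_pair]
    simp +contextual [Nat.Partrec.Code.eval]
  | right =>
    simp only [codeClauses, List.forall_mem_cons, Clause.Sat, List.map_cons, List.map_nil, numVal,
      holds_eval, holds_pair]
    simp +contextual [Nat.Partrec.Code.eval]
  | pair f g hf hg =>
    simp only [codeClauses, List.forall_mem_cons, List.forall_mem_append]
    refine ⟨?_, hf, hg⟩
    simp only [Clause.Sat, List.forall_mem_cons, List.map_cons, List.map_nil, numVal, holds_pair,
      holds_eval]
    rintro ρ ⟨h1, h2, h3, -⟩
    rw [h3]
    simp only [Nat.Partrec.Code.eval, Seq.seq, Part.mem_bind_iff, Part.map_eq_map,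
      Part.mem_map_iff]
    exact ⟨_, ⟨_, h1, rfl⟩, _, h2, rfl⟩
  | comp f g hf hg =>
    simp only [codeClauses, List.forall_mem_cons, List.forall_mem_append]
    refine ⟨?_, hf, hg⟩
    simp only [Clause.Sat, List.forall_mem_cons, List.map_cons, List.map_nil, numVal, holds_eval]
    rintro ρ ⟨h1, h2, -⟩
    exact Part.mem_bind h1 h2
  | prec f g hf hg =>
    simp only [codeClauses, List.forall_mem_cons, List.forall_mem_append]
    refine ⟨?_, ?_, hf, hg⟩
    · simp only [Clause.Sat, List.forall_mem_cons, List.map_cons, List.map_nil, numVal, holds_pair,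
        holds_eval]
      rintro ρ ⟨h1, h2, -⟩
      rw [h2, Nat.Partrec.Code.eval_prec_zero]
      exact h1
    · simp only [Clause.Sat, List.forall_mem_cons, List.map_cons, List.map_nil, numVal, holds_pair,
        holds_eval, holds_succ]
      rintro ρ ⟨h1, h2, h3, h4, h5, h6, h7, -⟩
      rw [h7, h6, Nat.Partrec.Code.eval_prec_succ]
      rw [h1] at h2
      rw [h4, h3] at h5
      exact Part.mem_bind h2 h5
  | rfind' f hf =>
    simp only [codeClauses, List.forall_mem_cons]
    refine ⟨?_, ?_, hf⟩
    · simp only [Clause.Sat, List.forall_mem_cons, List.map_cons, List.map_nil, numVal, holds_pair,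
        holds_eval]
      rintro ρ ⟨h1, h2, -⟩
      rw [h1] at h2 ⊢
      exact mem_eval_rfind'.2 (Or.inl ⟨h2, rfl⟩)
    · simp only [Clause.Sat, List.forall_mem_cons, List.map_cons, List.map_nil, numVal, holds_pair,
        holds_eval, holds_succ]
      rintro ρ ⟨h1, h2, h3, h4, h5, h6, -⟩
      rw [h5, h4] at h6
      rw [h3, h1] at h2
      rw [h1]
      exact mem_eval_rfind'.2 (Or.inr ⟨⟨_, h2⟩, h6⟩)

theorem progClause_sat (e : ℕ) : (progClause e).Sat (Holds e) := by
  intro ρ h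
  simp only [progClause, List.forall_mem_cons, List.map_cons, List.map_nil, numVal, holds_succ,
    holds_prog, List.forall_mem_map, List.mem_range] at h ⊢
  obtain ⟨h0, h⟩ := h
  have key : ∀ i ≤ e, ρ i = i + 1 := by
    intro i hi
    induction i with
    | zero => simpa using h0
    | succ i ih => rw [h i (by omega), ih (by omega)]
  exact key e le_rfl

theorem progClause_complete {I : ℕ → List ℕ → Prop} (hS : ∀ k, I predSucc [k, k + 1]) {e : ℕ}
    (h : (progClause e).Sat I) : I predProg [e + 1] := by
  refine h (fun i => i + 1) ?_
  simp only [progClause, List.forall_mem_cons, List.map_cons, List.map_nil, numVal,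
    List.forall_mem_map, List.mem_range]
  exact ⟨hS 0, fun i _ => hS (i + 1)⟩

section Complete

variable {I : ℕ → List ℕ → Prop} (hR : ∀ k, I predReal [k]) (hS : ∀ k, I predSucc [k, k + 1])
  (hA : ∀ C ∈ arithClauses, C.Sat I)
include hS hA

theorem arithClauses_complete_lt {a b : ℕ} (h : a < b) : I predLt [a, b] := by
  simp only [arithClauses, List.forall_mem_cons] at hA
  obtain ⟨h1, h2, -⟩ := hA
  obtain ⟨d, rfl⟩ := Nat.exists_eq_add_of_lt h
  clear h
  induction d with
  | zero =>
    refine h1 (fun i => a + i) ?_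
    simpa [numVal] using hS a
  | succ d ih =>
    have := h2 (fun i => if i = 0 then a else a + d + i)
    simp only [List.forall_mem_cons, List.map_cons, List.map_nil, numVal] at this
    exact this ⟨ih, hS _, by simp⟩

theorem arithClauses_complete_pair (a b : ℕ) : I predPair [a, b, Nat.pair a b] := by
  have hlt : ∀ {a b}, a < b → I predLt [a, b] := fun h => arithClauses_complete_lt hS hA h
  simp only [arithClauses, List.forall_mem_cons] at hA
  obtain ⟨-, -, h3, h4, h5, h6, h7, -⟩ := hA
  simp only [Clause.Sat, List.forall_mem_cons, List.map_cons, List.map_nil, numVal]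
    at h3 h4 h5 h6 h7
  have key : ∀ z, I predPair [z.unpair.1, z.unpair.2, z] := by
    intro z
    induction z with
    | zero => exact h3 (fun _ => 0) (by simp)
    | succ z ih =>
      obtain ⟨x, y, rfl⟩ : ∃ x y, z = Nat.pair x y := ⟨_, _, (Nat.pair_unpair z).symm⟩
      simp only [Nat.unpair_pair] at ih
      rcases lt_trichotomy (x + 1) y with h | h | h
      · rw [← Nat.pair_succ_left_of_lt h]
        simp only [Nat.unpair_pair]
        rw [Nat.pair_succ_left_of_lt h]
        exact h4 (fun i => [x, y, Nat.pair x y, x + 1, Nat.pair x y + 1].getD i 0)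
          ⟨ih, hS _, hlt h, hS _, by simp⟩
      · subst h
        rw [← Nat.pair_succ_zero]
        simp only [Nat.unpair_pair]
        rw [Nat.pair_succ_zero]
        exact h5 (fun i => [x, x + 1, Nat.pair x (x + 1), 0, Nat.pair x (x + 1) + 1].getD i 0)
          ⟨ih, hS _, hS _, by simp⟩
      · rcases Nat.lt_or_eq_of_le (Nat.le_of_lt_succ h) with h | h
        · rw [← Nat.pair_succ_right_of_lt h]
          simp only [Nat.unpair_pair]
          rw [Nat.pair_succ_right_of_lt h]
          exact h6 (fun i => [x, y, Nat.pair x y, y + 1, Nat.pair x y + 1].getD i 0)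
            ⟨ih, hlt h, hS _, hS _, by simp⟩
        · subst h
          rw [← Nat.pair_zero_succ]
          simp only [Nat.unpair_pair]
          rw [Nat.pair_zero_succ]
          exact h7 (fun i => [y, y, Nat.pair y y, y + 1, Nat.pair y y + 1].getD i 0)
            ⟨ih, hS _, hS _, by simp⟩
  simpa using key (Nat.pair a b)

include hR

theorem codeClauses_complete (c : Nat.Partrec.Code) (hc : ∀ C ∈ codeClauses c, C.Sat I)
    {a b : ℕ} (hab : b ∈ c.eval a) : I (predEval c) [a, b] := by
  have hP := arithClauses_complete_pair hS hA
  clear hA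
  induction c generalizing a b with
  | zero =>
    simp only [codeClauses, List.forall_mem_cons] at hc
    simp only [Nat.Partrec.Code.eval, Pure.pure, PFun.pure, Part.mem_some_iff] at hab
    subst hab
    exact hc.1 (fun _ => a) (by simpa [numVal] using hR a)
  | succ =>
    simp only [codeClauses, List.forall_mem_cons] at hc
    simp only [Nat.Partrec.Code.eval, PFun.coe_val, Part.mem_some_iff] at hab
    subst hab
    exact hc.1 (fun i => a + i) (by simpa [numVal] using hS a)
  | left =>
    simp only [codeClauses, List.forall_mem_cons] at hc
    simp only [Nat.Partrec.Code.eval, PFun.coe_val, Part.mem_some_iff] at hab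
    subst hab
    refine hc.1 (fun i => [a.unpair.1, a.unpair.2, a].getD i 0) ?_
    simpa [numVal] using hP a.unpair.1 a.unpair.2
  | right =>
    simp only [codeClauses, List.forall_mem_cons] at hc
    simp only [Nat.Partrec.Code.eval, PFun.coe_val, Part.mem_some_iff] at hab
    subst hab
    refine hc.1 (fun i => [a.unpair.1, a.unpair.2, a].getD i 0) ?_
    simpa [numVal] using hP a.unpair.1 a.unpair.2
  | pair f g hf hg =>
    simp only [codeClauses, List.forall_mem_cons, List.forall_mem_append] at hc
    obtain ⟨h1, hcf, hcg⟩ := hc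
    simp only [Nat.Partrec.Code.eval, Seq.seq, Part.mem_bind_iff, Part.map_eq_map,
      Part.mem_map_iff] at hab
    obtain ⟨_, ⟨x, hx, rfl⟩, y, hy, rfl⟩ := hab
    simp only [Clause.Sat, List.forall_mem_cons, List.map_cons, List.map_nil, numVal] at h1
    exact h1 (fun i => [a, x, y, Nat.pair x y].getD i 0)
      ⟨hf hcf hx, hg hcg hy, hP x y, by simp⟩
  | comp f g hf hg =>
    simp only [codeClauses, List.forall_mem_cons, List.forall_mem_append] at hc
    obtain ⟨h1, hcf, hcg⟩ := hc
    obtain ⟨x, hx, hb⟩ := Part.mem_bind_iff.1 hab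
    simp only [Clause.Sat, List.forall_mem_cons, List.map_cons, List.map_nil, numVal] at h1
    exact h1 (fun i => [a, x, b].getD i 0) ⟨hg hcg hx, hf hcf hb, by simp⟩
  | prec f g hf hg =>
    simp only [codeClauses, List.forall_mem_cons, List.forall_mem_append] at hc
    obtain ⟨h1, h2, hcf, hcg⟩ := hc
    simp only [Clause.Sat, List.forall_mem_cons, List.map_cons, List.map_nil, numVal] at h1 h2
    obtain ⟨x, n, rfl⟩ : ∃ x n, a = Nat.pair x n := ⟨_, _, (Nat.pair_unpair a).symm⟩
    induction n generalizing b with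
    | zero =>
      rw [Nat.Partrec.Code.eval_prec_zero] at hab
      exact h1 (fun i => [x, b, Nat.pair x 0].getD i 0) ⟨hf hcf hab, hP x 0, by simp⟩
    | succ n ih =>
      rw [Nat.Partrec.Code.eval_prec_succ] at hab
      obtain ⟨i, hi, hb⟩ := Part.mem_bind_iff.1 hab
      exact h2 (fun j => [x, n, Nat.pair x n, i, Nat.pair n i, Nat.pair x (Nat.pair n i), b,
          n + 1, Nat.pair x (n + 1)].getD j 0)
        ⟨hP _ _, ih hi, hP _ _, hP _ _, hg hcg hb, hS _, hP _ _, by simp⟩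
  | rfind' f hf =>
    simp only [codeClauses, List.forall_mem_cons] at hc
    obtain ⟨h1, h2, hcf⟩ := hc
    simp only [Clause.Sat, List.forall_mem_cons, List.map_cons, List.map_nil, numVal] at h1 h2
    obtain ⟨x, m, rfl⟩ : ∃ x m, a = Nat.pair x m := ⟨_, _, (Nat.pair_unpair a).symm⟩
    have hle : m ≤ b := by
      obtain ⟨n, -, rfl⟩ := mem_eval_rfind'_iff_exists.1 hab
      omega
    obtain ⟨d, rfl⟩ := Nat.exists_eq_add_of_le hle
    clear hle
    have hzero : ∀ {m}, 0 ∈ f.eval (Nat.pair x m) →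
        I (predEval f.rfind') [Nat.pair x m, m] := fun {m} h0 =>
      h1 (fun i => [x, m, Nat.pair x m].getD i 0) ⟨hP x m, hf hcf h0, by simp⟩
    have next : ∀ {m v k}, v + 1 ∈ f.eval (Nat.pair x m) →
        I (predEval f.rfind') [Nat.pair x (m + 1), k] →
        I (predEval f.rfind') [Nat.pair x m, k] := fun {m v k} hv hk =>
      h2 (fun i => [x, m, Nat.pair x m, v + 1, v, m + 1, Nat.pair x (m + 1), k].getD i 0)
        ⟨hP _ _, hf hcf hv, hS _, hS _, hP _ _, hk, by simp⟩
    induction d generalizing m with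
    | zero =>
      rcases mem_eval_rfind'.1 hab with ⟨h0, -⟩ | ⟨-, hk⟩
      · exact hzero h0
      · obtain ⟨n, -, hn⟩ := mem_eval_rfind'_iff_exists.1 hk
        omega
    | succ d ih =>
      rcases mem_eval_rfind'.1 hab with ⟨-, hd⟩ | ⟨⟨v, hv⟩, hk⟩
      · omega
      · rw [show m + (d + 1) = m + 1 + d by omega] at hk ⊢
        exact next hv (ih _ hk)

end Complete

/-! ### Datalog rules -/

theorem Rule.isDatalog_iff {R : Rule} :
    R.IsDatalog ↔ ∀ a ∈ R.head, ∀ v, Term.var v ∈ a.args → ∃ b ∈ R.body, Term.var v ∈ b.args := by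
  rw [Rule.IsDatalog, Rule.exVars, Finset.sdiff_eq_empty_iff_subset]
  simp only [Finset.subset_iff, FactBase.mem_vars]
  exact ⟨fun h a ha v hv => h ⟨a, ha, hv⟩, fun h v ⟨a, ha, hv⟩ => h a ha v hv⟩

theorem Rule.IsDatalog.mem_vars_body {R : Rule} (hR : R.IsDatalog) {a : Atom} (ha : a ∈ R.head)
    {v : ℕ} (hv : Term.var v ∈ a.args) : v ∈ FactBase.vars R.body :=
  FactBase.mem_vars.2 (Rule.isDatalog_iff.1 hR a ha v hv)

theorem SatisfiesRule.datalog {M : Set Atom} {R : Rule} (hM : SatisfiesRule M R)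
    (hR : R.IsDatalog) {σ : Subst} (hσ : IsHom σ ↑R.body M) : IsHom σ ↑R.head M := by
  obtain ⟨τ, hτ, hhead⟩ := hM σ hσ
  intro a ha
  rw [Atom.subst_congr fun v hv => (hτ v (hR.mem_vars_body ha hv)).symm]
  exact hhead a ha

theorem finite_lists_over {A : Set Term} (hA : A.Finite) (l : ℕ) :
    {ts : List Term | ts.length = l ∧ ∀ t ∈ ts, t ∈ A}.Finite := by
  induction l with
  | zero =>
    refine (Set.finite_singleton []).subset fun ts hts => ?_
    simpa using hts.1
  | succ l ih =>
    refine (hA.image2 List.cons ih).subset fun ts hts => ?_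
    obtain ⟨h1, h2⟩ := hts
    cases ts with
    | nil => simp at h1
    | cons t ts =>
      exact Set.mem_image2.2 ⟨t, h2 t (by simp), ts, ⟨by simpa using h1,
        fun s hs => h2 s (by simp [hs])⟩, rfl⟩

namespace Derivation

variable {𝓡 : RuleSet} {F : FactBase}

theorem limit_infinite (D : Derivation 𝓡 F) (hlen : D.len = ⊤) : D.limit.Infinite := by
  intro hfin
  obtain ⟨i, hi⟩ := D.exists_subset_fb hfin.toFinset (by simp)
  have hlt : (i : ℕ∞) < D.len := by simp [hlen]
  refine D.trig_new i hlt fun a ha => hi ?_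
  rw [Set.Finite.mem_toFinset]
  refine ⟨i + 1, ?_⟩
  rw [D.fb_succ i hlt]
  exact Finset.mem_union_right _ ha

/-- An infinite derivation applies non-Datalog rules arbitrarily late. -/
theorem exists_not_isDatalog (D : Derivation 𝓡 F) (hlen : D.len = ⊤) (T : ℕ) :
    ∃ j ≥ T, ¬ (D.tr j).rule.IsDatalog := by
  by_contra hcon
  push Not at hcon
  set B : Finset Atom := D.fb T ∪ 𝓡.sup Rule.head with hB
  set A : Set Term := ⋃ a ∈ B, {t | t ∈ a.args} with hA
  have hAfin : A.Finite := B.finite_toSet.biUnion fun a _ => a.args.finite_toSet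
  set U : Set Atom := ⋃ b ∈ B, Atom.mk b.pred '' {ts | ts.length = b.args.length ∧ ∀ t ∈ ts, t ∈ A}
    with hU
  have hUfin : U.Finite := B.finite_toSet.biUnion fun b _ => (finite_lists_over hAfin _).image _
  have hmemA : ∀ {a t}, a ∈ B → t ∈ a.args → t ∈ A := fun {a t} ha ht =>
    Set.mem_iUnion₂.2 ⟨a, ha, ht⟩
  have hsub : ∀ k, ∀ a ∈ D.fb (T + k), a ∈ U := by
    intro k
    induction k with
    | zero =>
      intro a ha
      have haB : a ∈ B := Finset.mem_union_left _ ha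
      exact Set.mem_iUnion₂.2 ⟨a, haB, a.args, ⟨rfl, fun t ht => hmemA haB ht⟩, rfl⟩
    | succ k ih =>
      intro a ha
      have hlt : ((T + k : ℕ) : ℕ∞) < D.len := hlen ▸ ENat.natCast_lt_top _
      rw [← Nat.add_assoc, D.fb_succ _ hlt, Finset.mem_union] at ha
      rcases ha with ha | ha
      · exact ih a ha
      obtain ⟨b, hb, rfl⟩ := Finset.mem_image.1 ha
      have hbB : b ∈ B := Finset.mem_union_right _ (Finset.mem_sup.2 ⟨_, D.rule_mem _ hlt, hb⟩)
      refine Set.mem_iUnion₂.2 ⟨b, hbB, (b.subst (D.tr (T + k)).ext).args,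
        ⟨by simp [Atom.subst], fun t ht => ?_⟩, rfl⟩
      obtain ⟨s, hs, rfl⟩ := List.mem_map.1 ht
      cases s with
      | const c => exact hmemA hbB hs
      | var v =>
        have hv := (hcon (T + k) (Nat.le_add_right _ _)).mem_vars_body hb hs
        change (D.tr (T + k)).ext v ∈ A
        rw [Trigger.ext_of_mem_body hv]
        obtain ⟨c, hc, hvc⟩ := (D.trig_on _ hlt).map_mem_args hv
        obtain ⟨d, -, ts, ⟨-, hts⟩, rfl⟩ := Set.mem_iUnion₂.1 (ih c hc)
        exact hts _ hvc
  refine D.limit_infinite hlen (hUfin.subset ?_)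
  rintro a ⟨i, hi⟩
  exact hsub i a (D.fb_mono (Nat.le_add_left _ _) hi)

end Derivation

/-! ### The rule set -/

/-- The least element of every chain. -/
abbrev cZero : Term := .const 0
/-- The brake of every chain. -/
abbrev cBrake : Term := .const 1
/-- The owner of the spine. -/
abbrev cSpine : Term := .const 2

/-- The rule term denoting a numeric term. -/
def numTerm : Option ℕ → Term
  | none => cZero
  | some i => .var (i + 1)

/-- A numeric atom about the chain owned by the variable `0`. -/
def ownedAtom (b : NumAtom) : Atom := ⟨b.1, .var 0 :: b.2.map numTerm⟩

/-- The rule stating a Horn clause for each chain. -/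
def Clause.toRule (C : Clause) : Rule where
  body := insert ⟨predReal, [.var 0, cZero]⟩ (C.body.map ownedAtom).toFinset
  head := {ownedAtom C.head}
  body_nonempty := Finset.insert_nonempty _ _
  head_nonempty := Finset.singleton_nonempty _

/-- Extends a chain by a new element, unless the brake is real. -/
def growRule : Rule where
  body := {⟨predReal, [.var 0, .var 1]⟩, ⟨predEdge, [.var 0, .var 1, cBrake]⟩,
    ⟨predEdge, [.var 0, cBrake, cBrake]⟩}
  head := {⟨predEdge, [.var 0, .var 1, .var 2]⟩, ⟨predReal, [.var 0, .var 2]⟩,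
    ⟨predEdge, [.var 0, .var 2, cBrake]⟩}
  body_nonempty := Finset.insert_nonempty _ _
  head_nonempty := Finset.insert_nonempty _ _

/-- Makes the brake of the spine real. -/
def brakeRule : Rule where
  body := {⟨predReal, [cSpine, cZero]⟩}
  head := {⟨predReal, [cSpine, cBrake]⟩}
  body_nonempty := Finset.singleton_nonempty _
  head_nonempty := Finset.singleton_nonempty _

/-- Starts a chain for each element of the spine. -/
def startRule : Rule where
  body := {⟨predReal, [cSpine, .var 0]⟩}
  head := {⟨predReal, [.var 0, cZero]⟩, ⟨predEdge, [.var 0, cZero, cBrake]⟩,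
    ⟨predEdge, [.var 0, cBrake, cBrake]⟩, ⟨predMatch, [.var 0, cZero, cZero]⟩}
  body_nonempty := Finset.singleton_nonempty _
  head_nonempty := Finset.insert_nonempty _ _

/-- Edges to real elements are successors. -/
def succRule : Rule where
  body := {⟨predEdge, [.var 0, .var 1, .var 2]⟩, ⟨predReal, [.var 0, .var 2]⟩}
  head := {⟨predSucc, [.var 0, .var 1, .var 2]⟩}
  body_nonempty := Finset.insert_nonempty _ _
  head_nonempty := Finset.singleton_nonempty _

/-- Propagates the correspondence between the spine and a chain. -/
def matchRule : Rule where
  body := {⟨predMatch, [.var 0, .var 1, .var 2]⟩, ⟨predSucc, [cSpine, .var 1, .var 3]⟩,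
    ⟨predSucc, [.var 0, .var 2, .var 4]⟩}
  head := {⟨predMatch, [.var 0, .var 3, .var 4]⟩}
  body_nonempty := Finset.insert_nonempty _ _
  head_nonempty := Finset.singleton_nonempty _

/-- Makes the brake of a chain real when the computation for its owner has halted. -/
def haltRule (u : Nat.Partrec.Code) : Rule where
  body := {⟨predReal, [.var 0, cZero]⟩, ⟨predMatch, [.var 0, .var 0, .var 1]⟩,
    ⟨predProg, [.var 0, .var 2]⟩, ⟨predPair, [.var 0, .var 2, .var 1, .var 3]⟩,
    ⟨predEval u, [.var 0, .var 3, .var 4]⟩}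
  head := {⟨predReal, [.var 0, cBrake]⟩}
  body_nonempty := Finset.insert_nonempty _ _
  head_nonempty := Finset.singleton_nonempty _

/-- The rules that do not depend on the simulated program. -/
def simRules (u : Nat.Partrec.Code) : RuleSet :=
  {growRule, brakeRule, startRule, succRule, matchRule, haltRule u} ∪
    ((arithClauses ++ codeClauses u).map Clause.toRule).toFinset

/-- The rule set simulating the computations of `u` on the pairs of `e + 1` and some `n`. -/
def haltingRules (u : Nat.Partrec.Code) (e : ℕ) : RuleSet :=
  insert (progClause e).toRule (simRules u)

/-- The initial factbase: a spine consisting of zero only. -/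
def spineBase : FactBase :=
  {⟨predReal, [cSpine, cZero]⟩, ⟨predEdge, [cSpine, cZero, cBrake]⟩,
    ⟨predEdge, [cSpine, cBrake, cBrake]⟩}

/-- The clauses used by the simulation. -/
def simClauses (u : Nat.Partrec.Code) (e : ℕ) : List Clause :=
  progClause e :: (arithClauses ++ codeClauses u)

theorem mem_haltingRules {u : Nat.Partrec.Code} {e : ℕ} {R : Rule} :
    R ∈ haltingRules u e ↔ (R = growRule ∨ R = brakeRule ∨ R = startRule ∨ R = succRule ∨
      R = matchRule ∨ R = haltRule u) ∨ ∃ C ∈ simClauses u e, R = C.toRule := by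
  simp only [haltingRules, simRules, simClauses, Finset.mem_insert, Finset.mem_union,
    Finset.mem_singleton, List.mem_toFinset, List.mem_map, List.mem_cons, exists_eq_or_imp,
    eq_comm (b := R)]
  tauto

/-- The syntactic conditions on clauses needed by the simulation. -/
def Clause.Good (C : Clause) : Prop :=
  C.Safe ∧ (∀ b ∈ C.body, b.1 ≠ predEdge ∧ b.1 ≠ predMatch) ∧ predMatch < C.head.1

theorem predMatch_lt_predEval (c : Nat.Partrec.Code) : predMatch < predEval c := by
  unfold predMatch predEval
  omega

theorem arithClauses_good : ∀ C ∈ arithClauses, C.Good := by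
  simp only [arithClauses, List.forall_mem_cons]
  refine ⟨?_, ?_, ?_, ?_, ?_, ?_, ?_, by simp⟩ <;>
    refine ⟨by simp [Clause.Safe], ?_, by decide⟩ <;> simp only [List.forall_mem_cons] <;> simp

theorem codeClauses_good (c : Nat.Partrec.Code) : ∀ C ∈ codeClauses c, C.Good := by
  have h1 : ∀ c, predEval c ≠ predEdge := fun c => (predEval_ne (show 1 < 7 by omega) c).symm
  have h2 : ∀ c, predEval c ≠ predMatch := fun c => (predEval_ne (show 3 < 7 by omega) c).symm
  have h3 := predMatch_lt_predEval
  induction c with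
  | zero => simpa [codeClauses, Clause.Good, Clause.Safe] using h3 _
  | succ => simpa [codeClauses, Clause.Good, Clause.Safe] using h3 _
  | left => simpa [codeClauses, Clause.Good, Clause.Safe] using h3 _
  | right => simpa [codeClauses, Clause.Good, Clause.Safe] using h3 _
  | pair f g hf hg =>
    simp only [codeClauses, List.forall_mem_cons, List.forall_mem_append]
    refine ⟨⟨?_, ?_, h3 _⟩, hf, hg⟩
    · simp [Clause.Safe]
    · simp only [List.forall_mem_cons]
      simp [h1, h2]
  | comp f g hf hg =>
    simp only [codeClauses, List.forall_mem_cons, List.forall_mem_append]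
    refine ⟨⟨?_, ?_, h3 _⟩, hf, hg⟩
    · simp [Clause.Safe]
    · simp only [List.forall_mem_cons]
      simp [h1, h2]
  | prec f g hf hg =>
    simp only [codeClauses, List.forall_mem_cons, List.forall_mem_append]
    refine ⟨⟨?_, ?_, h3 _⟩, ⟨?_, ?_, h3 _⟩, hf, hg⟩
    · simp [Clause.Safe]
    · simp only [List.forall_mem_cons]
      simp [h1, h2]
    · simp [Clause.Safe]
    · simp only [List.forall_mem_cons]
      simp [h1, h2]
  | rfind' f hf =>
    simp only [codeClauses, List.forall_mem_cons]
    refine ⟨⟨?_, ?_, h3 _⟩, ⟨?_, ?_, h3 _⟩, hf⟩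
    · simp [Clause.Safe]
    · simp only [List.forall_mem_cons]
      simp [h1, h2]
    · simp [Clause.Safe]
    · simp only [List.forall_mem_cons]
      simp [h1, h2]

theorem progClause_good (e : ℕ) : (progClause e).Good := by
  refine ⟨?_, ?_, ?_⟩
  · intro i hi
    simp only [progClause, List.mem_singleton, Option.some.injEq] at hi ⊢
    subst hi
    cases i with
    | zero => exact ⟨_, List.mem_cons_self, by simp⟩
    | succ i =>
      refine ⟨_, List.mem_cons_of_mem _ (List.mem_map.2 ⟨i, by simp, rfl⟩), by simp⟩
  · simp [progClause]
  · show 3 < 6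
    omega

theorem simClauses_good {u : Nat.Partrec.Code} {e : ℕ} : ∀ C ∈ simClauses u e, C.Good := by
  simp only [simClauses, List.forall_mem_cons, List.forall_mem_append]
  exact ⟨progClause_good e, arithClauses_good, codeClauses_good u⟩

theorem simClauses_sat {u : Nat.Partrec.Code} {e : ℕ} :
    ∀ C ∈ simClauses u e, C.Sat (Holds e) := by
  simp only [simClauses, List.forall_mem_cons, List.forall_mem_append]
  exact ⟨progClause_sat e, arithClauses_sat e, codeClauses_sat e u⟩

theorem Clause.mem_toRule_body {C : Clause} {a : Atom} :
    a ∈ C.toRule.body ↔ a = ⟨predReal, [.var 0, cZero]⟩ ∨ ∃ b ∈ C.body, a = ownedAtom b := by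
  simp [Clause.toRule, eq_comm]

theorem Clause.Safe.isDatalog_toRule {C : Clause} (hC : C.Safe) : C.toRule.IsDatalog := by
  rw [Rule.isDatalog_iff]
  intro a ha v hv
  rw [Clause.toRule, Finset.mem_singleton] at ha
  subst ha
  simp only [ownedAtom, List.mem_cons, Term.var.injEq, List.mem_map] at hv
  rcases hv with rfl | ⟨o, ho, hov⟩
  · exact ⟨_, Clause.mem_toRule_body.2 (Or.inl rfl), by simp⟩
  · cases o with
    | none => simp [numTerm] at hov
    | some i =>
      obtain ⟨b, hb, hib⟩ := hC i ho
      refine ⟨_, Clause.mem_toRule_body.2 (Or.inr ⟨b, hb, rfl⟩), ?_⟩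
      rw [← hov]
      exact List.mem_cons_of_mem _ (List.mem_map_of_mem hib)

theorem brakeRule_isDatalog : brakeRule.IsDatalog := by
  simp [Rule.isDatalog_iff, brakeRule]

theorem startRule_isDatalog : startRule.IsDatalog := by
  simp [Rule.isDatalog_iff, startRule]

theorem succRule_isDatalog : succRule.IsDatalog := by
  simp [Rule.isDatalog_iff, succRule]

theorem matchRule_isDatalog : matchRule.IsDatalog := by
  simp [Rule.isDatalog_iff, matchRule]

theorem haltRule_isDatalog (u : Nat.Partrec.Code) : (haltRule u).IsDatalog := by
  simp [Rule.isDatalog_iff, haltRule]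

theorem eq_growRule_of_not_isDatalog {u : Nat.Partrec.Code} {e : ℕ} {R : Rule}
    (hR : R ∈ haltingRules u e) (h : ¬ R.IsDatalog) : R = growRule := by
  rcases mem_haltingRules.1 hR with (rfl | rfl | rfl | rfl | rfl | rfl) | ⟨C, hC, rfl⟩
  · rfl
  · exact absurd brakeRule_isDatalog h
  · exact absurd startRule_isDatalog h
  · exact absurd succRule_isDatalog h
  · exact absurd matchRule_isDatalog h
  · exact absurd (haltRule_isDatalog u) h
  · exact absurd (simClauses_good C hC).1.isDatalog_toRule h

/-! ### Consequences of the rules in a model -/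

/-- The substitution mapping the `i`-th variable to the `i`-th element of a list. -/
def listSubst (ts : List Term) : Subst := fun v => ts.getD v cZero

section Model

variable {G : Set Atom} {x : Term}

theorem SatisfiesRule.grow (h : SatisfiesRule G growRule) {a : Term}
    (h1 : ⟨predReal, [x, a]⟩ ∈ G) (h2 : ⟨predEdge, [x, a, cBrake]⟩ ∈ G)
    (h3 : ⟨predEdge, [x, cBrake, cBrake]⟩ ∈ G) :
    ∃ b, ⟨predEdge, [x, a, b]⟩ ∈ G ∧ ⟨predReal, [x, b]⟩ ∈ G ∧ ⟨predEdge, [x, b, cBrake]⟩ ∈ G := by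
  obtain ⟨τ, hτ, hhead⟩ := h (listSubst [x, a]) (by
    simp [IsHom, growRule, Atom.subst, applyTerm, listSubst, h1, h2, h3])
  have h0 : τ 0 = x := hτ 0 (FactBase.mem_vars.2 ⟨⟨predReal, [.var 0, .var 1]⟩, by simp [growRule]⟩)
  have h1 : τ 1 = a := hτ 1 (FactBase.mem_vars.2 ⟨⟨predReal, [.var 0, .var 1]⟩, by simp [growRule]⟩)
  refine ⟨τ 2, ?_⟩
  simpa [IsHom, growRule, Atom.subst, applyTerm, h0, h1] using hhead

theorem SatisfiesRule.brake (h : SatisfiesRule G brakeRule)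
    (h1 : ⟨predReal, [cSpine, cZero]⟩ ∈ G) : ⟨predReal, [cSpine, cBrake]⟩ ∈ G := by
  have := h.datalog brakeRule_isDatalog (σ := listSubst []) (by
    simp [IsHom, brakeRule, Atom.subst, applyTerm, h1])
  simpa [IsHom, brakeRule, Atom.subst, applyTerm] using this

theorem SatisfiesRule.start (h : SatisfiesRule G startRule)
    (h1 : ⟨predReal, [cSpine, x]⟩ ∈ G) :
    ⟨predReal, [x, cZero]⟩ ∈ G ∧ ⟨predEdge, [x, cZero, cBrake]⟩ ∈ G ∧
      ⟨predEdge, [x, cBrake, cBrake]⟩ ∈ G ∧ ⟨predMatch, [x, cZero, cZero]⟩ ∈ G := by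
  have := h.datalog startRule_isDatalog (σ := listSubst [x]) (by
    simp [IsHom, startRule, Atom.subst, applyTerm, listSubst, h1])
  simpa [IsHom, startRule, Atom.subst, applyTerm, listSubst] using this

theorem SatisfiesRule.succ (h : SatisfiesRule G succRule) {a b : Term}
    (h1 : ⟨predEdge, [x, a, b]⟩ ∈ G) (h2 : ⟨predReal, [x, b]⟩ ∈ G) :
    ⟨predSucc, [x, a, b]⟩ ∈ G := by
  have := h.datalog succRule_isDatalog (σ := listSubst [x, a, b]) (by
    simp [IsHom, succRule, Atom.subst, applyTerm, listSubst, h1, h2])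
  simpa [IsHom, succRule, Atom.subst, applyTerm, listSubst] using this

theorem SatisfiesRule.match (h : SatisfiesRule G matchRule) {z a z' a' : Term}
    (h1 : ⟨predMatch, [x, z, a]⟩ ∈ G) (h2 : ⟨predSucc, [cSpine, z, z']⟩ ∈ G)
    (h3 : ⟨predSucc, [x, a, a']⟩ ∈ G) : ⟨predMatch, [x, z', a']⟩ ∈ G := by
  have := h.datalog matchRule_isDatalog (σ := listSubst [x, z, a, z', a']) (by
    simp [IsHom, matchRule, Atom.subst, applyTerm, listSubst, h1, h2, h3])
  simpa [IsHom, matchRule, Atom.subst, applyTerm, listSubst] using this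

theorem SatisfiesRule.halt {u : Nat.Partrec.Code} (h : SatisfiesRule G (haltRule u))
    {a q b c : Term} (h1 : ⟨predReal, [x, cZero]⟩ ∈ G) (h2 : ⟨predMatch, [x, x, a]⟩ ∈ G)
    (h3 : ⟨predProg, [x, q]⟩ ∈ G) (h4 : ⟨predPair, [x, q, a, b]⟩ ∈ G)
    (h5 : ⟨predEval u, [x, b, c]⟩ ∈ G) : ⟨predReal, [x, cBrake]⟩ ∈ G := by
  have := h.datalog (haltRule_isDatalog u) (σ := listSubst [x, a, q, b, c]) (by
    simp [IsHom, haltRule, Atom.subst, applyTerm, listSubst, h1, h2, h3, h4, h5])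
  simpa [IsHom, haltRule, Atom.subst, applyTerm, listSubst] using this

theorem SatisfiesRule.clause {C : Clause} (h : SatisfiesRule G C.toRule) (hC : C.Safe)
    (h1 : ⟨predReal, [x, cZero]⟩ ∈ G) {a : ℕ → Term} (ha : a 0 = cZero) :
    C.Sat fun p ks => ⟨p, x :: ks.map a⟩ ∈ G := by
  intro ρ hρ
  set σ : Subst := fun v => Nat.casesOn v x fun i => a (ρ i) with hσ
  have key : ∀ b : NumAtom, (ownedAtom b).subst σ = ⟨b.1, x :: (b.2.map (numVal ρ)).map a⟩ := by
    intro b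
    simp only [ownedAtom, Atom.subst, List.map_cons, List.map_map, Atom.mk.injEq, true_and]
    refine congr_arg₂ _ rfl (List.map_congr_left fun o _ => ?_)
    cases o with
    | none => simp [numTerm, applyTerm, numVal, ha]
    | some i => simp [numTerm, applyTerm, numVal, hσ]
  have := h.datalog hC.isDatalog_toRule (σ := σ) (by
    intro b hb
    rcases Clause.mem_toRule_body.1 (Finset.mem_coe.1 hb) with rfl | ⟨c, hc, rfl⟩
    · simpa [Atom.subst, applyTerm, hσ] using h1
    · rw [key]
      exact hρ c hc)
  have h2 := this (ownedAtom C.head) (by simp [Clause.toRule])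
  rwa [key] at h2

/-- In a model, every chain is infinite. -/
theorem SatisfiesRule.exists_chain (h : SatisfiesRule G growRule)
    (h1 : ⟨predReal, [x, cZero]⟩ ∈ G) (h2 : ⟨predEdge, [x, cZero, cBrake]⟩ ∈ G)
    (h3 : ⟨predEdge, [x, cBrake, cBrake]⟩ ∈ G) :
    ∃ a : ℕ → Term, a 0 = cZero ∧ ∀ k, ⟨predReal, [x, a k]⟩ ∈ G ∧
      ⟨predEdge, [x, a k, a (k + 1)]⟩ ∈ G := by
  choose f hf using fun p : {a : Term // ⟨predReal, [x, a]⟩ ∈ G ∧ ⟨predEdge, [x, a, cBrake]⟩ ∈ G} =>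
    h.grow p.2.1 p.2.2 h3
  let a : ℕ → {a : Term // ⟨predReal, [x, a]⟩ ∈ G ∧ ⟨predEdge, [x, a, cBrake]⟩ ∈ G} :=
    fun k => Nat.rec ⟨cZero, h1, h2⟩ (fun _ p => ⟨f p, (hf p).2⟩) k
  exact ⟨fun k => (a k).1, rfl, fun k => ⟨(a k).2.1, (hf (a k)).1⟩⟩

/-- `SpineReach G k z` states that `z` is reachable from zero by `k` steps on the spine. -/
inductive SpineReach (G : Set Atom) : ℕ → Term → Prop
  | zero : SpineReach G 0 cZero
  | succ {k : ℕ} {z z' : Term} : SpineReach G k z → ⟨predSucc, [cSpine, z, z']⟩ ∈ G →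
      SpineReach G (k + 1) z'

/-- In a model, the brake of the chain of the `n`-th element of the spine is real if the
simulated program halts on `n`. -/
theorem IsModelOfRules.real_brake {u : Nat.Partrec.Code} {e n : ℕ}
    (hG : IsModelOfRules (haltingRules u e) G) (hx : ⟨predReal, [cSpine, x]⟩ ∈ G)
    (hn : SpineReach G n x) (hdom : (u.eval (Nat.pair (e + 1) n)).Dom) :
    ⟨predReal, [x, cBrake]⟩ ∈ G := by
  have hrule : ∀ {R}, _ → SatisfiesRule G R := fun {R} hR => hG R (mem_haltingRules.2 hR)
  obtain ⟨h1, h2, h3, h4⟩ := (hrule (R := startRule) (by simp)).start hx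
  obtain ⟨a, ha0, ha⟩ := (hrule (R := growRule) (by simp)).exists_chain h1 h2 h3
  have hS : ∀ k, ⟨predSucc, [x, a k, a (k + 1)]⟩ ∈ G := fun k =>
    (hrule (R := succRule) (by simp)).succ (ha k).2 (ha (k + 1)).1
  have hM : ∀ {k z}, SpineReach G k z → ⟨predMatch, [x, z, a k]⟩ ∈ G := by
    intro k z hz
    induction hz with
    | zero => rwa [ha0]
    | succ _ hs ih => exact (hrule (R := matchRule) (by simp)).match ih hs (hS _)
  have hC : ∀ C ∈ simClauses u e, C.Sat fun p ks => ⟨p, x :: ks.map a⟩ ∈ G := fun C hC =>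
    (hrule (Or.inr ⟨C, hC, rfl⟩)).clause (simClauses_good C hC).1 h1 ha0
  simp only [simClauses, List.forall_mem_cons, List.forall_mem_append] at hC
  obtain ⟨hprog, harith, hcode⟩ := hC
  obtain ⟨r, hr⟩ := Part.dom_iff_mem.1 hdom
  have hp := progClause_complete hS hprog
  have hpair := arithClauses_complete_pair hS harith (e + 1) n
  have heval := codeClauses_complete (fun k => (ha k).1) hS harith u hcode hr
  exact (hrule (R := haltRule u) (by simp)).halt h1 (hM hn) hp hpair heval

end Model

/-! ### Finiteness of the derivations for total programs -/

section Triggers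

variable {t : Trigger} {E : FactBase} {u : Nat.Partrec.Code} {e : ℕ}

theorem growRule_isOn (ht : t.rule = growRule) (hon : t.IsOn E) :
    ⟨predReal, [t.map 0, t.map 1]⟩ ∈ E ∧ ⟨predEdge, [t.map 0, t.map 1, cBrake]⟩ ∈ E ∧
      ⟨predEdge, [t.map 0, cBrake, cBrake]⟩ ∈ E := by
  simpa [Trigger.IsOn, ht, IsHom, growRule, Atom.subst, applyTerm] using hon

theorem growRule_out (ht : t.rule = growRule) :
    t.out = {⟨predEdge, [t.map 0, t.map 1, .var (t.freshVar 2)]⟩,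
      ⟨predReal, [t.map 0, .var (t.freshVar 2)]⟩,
      ⟨predEdge, [t.map 0, .var (t.freshVar 2), cBrake]⟩} := by
  have h0 : t.ext 0 = t.map 0 := Trigger.ext_of_mem_body
    (FactBase.mem_vars.2 ⟨⟨predReal, [.var 0, .var 1]⟩, by simp [growRule, ht]⟩)
  have h1 : t.ext 1 = t.map 1 := Trigger.ext_of_mem_body
    (FactBase.mem_vars.2 ⟨⟨predReal, [.var 0, .var 1]⟩, by simp [growRule, ht]⟩)
  have h2 : t.ext 2 = .var (t.freshVar 2) := by
    rw [Trigger.ext, if_pos]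
    rw [Rule.mem_exVars, FactBase.mem_vars, FactBase.mem_vars]
    simp [ht, growRule]
  simp [Trigger.out, ht, growRule, Finset.image_insert, Atom.subst, applyTerm, h0, h1, h2]

/-- The brake blocks the growth of a chain. -/
theorem growRule_not_applicable (hE : FreshInv E) (ht : t.rule = growRule) (hon : t.IsOn E)
    (hw : ⟨predReal, [t.map 0, cBrake]⟩ ∈ E) : ¬ Applicable .R t E := by
  obtain ⟨-, h2, h3⟩ := growRule_isOn ht hon
  refine hE.not_applicable hon (σ := Function.update t.map 2 cBrake) (fun v hv => ?_) ?_
  · refine Function.update_of_ne ?_ _ _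
    rintro rfl
    rw [FactBase.mem_vars] at hv
    simp [ht, growRule] at hv
  · simp [ht, growRule, IsHom, Atom.subst, applyTerm, h2, h3, hw]

theorem real_mem_out (ht : t.rule ∈ haltingRules u e) (hon : t.IsOn E) {x a : Term}
    (ha : ⟨predReal, [x, a]⟩ ∈ t.out) :
    (t.rule = growRule ∧ x = t.map 0 ∧ ⟨predEdge, [x, t.map 1, a]⟩ ∈ t.out) ∨
      (x = cSpine ∧ a = cBrake) ∨ (a = cZero ∧ ⟨predReal, [cSpine, x]⟩ ∈ E) ∨
      (a = cBrake ∧ ⟨predReal, [x, cZero]⟩ ∈ E) := by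
  rcases mem_haltingRules.1 ht with (ht | ht | ht | ht | ht | ht) | ⟨C, hC, ht⟩
  · left
    rw [growRule_out ht] at ha ⊢
    simp at ha
    simp [ht, ha]
  · right; left
    rw [Trigger.out, ht] at ha
    simpa [brakeRule, Atom.subst, applyTerm, eq_comm] using ha
  · right; right; left
    have h0 : t.ext 0 = t.map 0 := Trigger.ext_of_mem_body
      (FactBase.mem_vars.2 ⟨⟨predReal, [cSpine, .var 0]⟩, by simp [startRule, ht]⟩)
    rw [Trigger.out, ht] at ha
    simp only [Trigger.IsOn, ht] at hon
    simp [startRule, Atom.subst, applyTerm, h0] at ha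
    simp [startRule, Atom.subst, applyTerm, IsHom] at hon
    rw [ha.1, ha.2]
    exact ⟨rfl, hon⟩
  · rw [Trigger.out, ht] at ha
    simp [succRule, Atom.subst] at ha
  · rw [Trigger.out, ht] at ha
    simp [matchRule, Atom.subst] at ha
  · right; right; right
    have h0 : t.ext 0 = t.map 0 := Trigger.ext_of_mem_body
      (FactBase.mem_vars.2 ⟨⟨predReal, [.var 0, cZero]⟩, by simp [haltRule, ht]⟩)
    rw [Trigger.out, ht] at ha
    simp only [Trigger.IsOn, ht] at hon
    simp [haltRule, Atom.subst, applyTerm, h0] at ha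
    simp [haltRule, Atom.subst, applyTerm, IsHom] at hon
    rw [ha.1, ha.2]
    exact ⟨rfl, hon.1⟩
  · have hlt := (simClauses_good C hC).2.2
    rw [Trigger.out, ht] at ha
    simp [Clause.toRule, ownedAtom, Atom.subst] at ha
    rw [← ha.1] at hlt
    simp at hlt

/-- The owner of a chain other than the spine is an element of the spine. -/
theorem owner_invariant (hE : ∀ x a, ⟨predReal, [x, a]⟩ ∈ E →
    x = cSpine ∨ ⟨predReal, [cSpine, x]⟩ ∈ E)
    (ht : t.rule ∈ haltingRules u e) (hon : t.IsOn E) :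
    ∀ x a, ⟨predReal, [x, a]⟩ ∈ E ∪ t.out → x = cSpine ∨ ⟨predReal, [cSpine, x]⟩ ∈ E ∪ t.out := by
  intro x a ha
  suffices x = cSpine ∨ ⟨predReal, [cSpine, x]⟩ ∈ E from
    this.imp_right fun h => Finset.mem_union_left _ h
  rcases Finset.mem_union.1 ha with ha | ha
  · exact hE x a ha
  rcases real_mem_out ht hon ha with ⟨hr, rfl, -⟩ | ⟨rfl, -⟩ | ⟨-, h⟩ | ⟨-, h⟩
  · exact hE _ _ (growRule_isOn hr hon).1
  · exact Or.inl rfl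
  · exact Or.inr h
  · exact hE _ _ h

/-- The elements of the spine are reachable. -/
theorem reach_invariant {G : Set Atom} (hG : IsModelOfRules (haltingRules u e) G)
    (hbase : (spineBase : Set Atom) ⊆ G)
    (hE : (E : Set Atom) ⊆ G → ∀ x, ⟨predReal, [cSpine, x]⟩ ∈ E → ∃ k, SpineReach G k x)
    (ht : t.rule ∈ haltingRules u e) (hon : t.IsOn E) (hsub : (↑(E ∪ t.out) : Set Atom) ⊆ G) :
    ∀ x, ⟨predReal, [cSpine, x]⟩ ∈ E ∪ t.out → ∃ k, SpineReach G k x := by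
  rw [Finset.coe_union, Set.union_subset_iff] at hsub
  have hsucc := hG succRule (mem_haltingRules.2 (by simp))
  intro x ha
  rcases Finset.mem_union.1 ha with ha | ha
  · exact hE hsub.1 x ha
  have hbrake : x = cBrake → ∃ k, SpineReach G k x := by
    rintro rfl
    exact ⟨1, SpineReach.zero.succ (hsucc.succ (hbase (by simp [spineBase])) (hsub.2 ha))⟩
  rcases real_mem_out ht hon ha with ⟨hr, hx, h⟩ | ⟨-, h⟩ | ⟨rfl, h⟩ | ⟨h, -⟩
  · obtain ⟨k, hk⟩ := hE hsub.1 (t.map 1) (hx ▸ (growRule_isOn hr hon).1)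
    exact ⟨k + 1, hk.succ (hsucc.succ (hsub.2 h) (hsub.2 ha))⟩
  · exact hbrake h
  · exact ⟨0, SpineReach.zero⟩
  · exact hbrake h

end Triggers

theorem freshInv_spineBase : FreshInv spineBase := by
  refine freshInv_of_vars_eq_empty (Finset.eq_empty_of_forall_notMem fun v hv => ?_)
  rw [FactBase.mem_vars] at hv
  simp [spineBase] at hv

/-- If the simulated program is total, then all fair R-derivations are finite. -/
theorem finite_of_total {u : Nat.Partrec.Code} {e : ℕ}
    (htot : ∀ n, (u.eval (Nat.pair (e + 1) n)).Dom) (D : Derivation (haltingRules u e) spineBase)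
    (hX : D.IsX .R) (hfair : D.Fair .R) : D.Finite := by
  intro hlen
  have hlt : ∀ i : ℕ, (i : ℕ∞) < D.len := fun i => hlen ▸ ENat.natCast_lt_top i
  set G := D.limit
  have hG : IsModelOfRules (haltingRules u e) G := D.limit_isModelOfRules hfair hlen
  have hbase : (spineBase : Set Atom) ⊆ G := D.fb_zero ▸ D.fb_subset_limit 0
  have hfresh : ∀ i, FreshInv (D.fb i) :=
    D.invariant freshInv_spineBase fun E t hE _ hon => hE.union_out hon
  have howner : ∀ i x a, ⟨predReal, [x, a]⟩ ∈ D.fb i →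
      x = cSpine ∨ ⟨predReal, [cSpine, x]⟩ ∈ D.fb i :=
    D.invariant (P := fun E => ∀ x a, ⟨predReal, [x, a]⟩ ∈ E →
      x = cSpine ∨ ⟨predReal, [cSpine, x]⟩ ∈ E)
      (by simp +contextual [spineBase]) fun E t hE ht hon => owner_invariant hE ht hon
  have hreach : ∀ i x, ⟨predReal, [cSpine, x]⟩ ∈ D.fb i → ∃ k, SpineReach G k x := fun i =>
    D.invariant (P := fun E => (E : Set Atom) ⊆ G →
      ∀ x, ⟨predReal, [cSpine, x]⟩ ∈ E → ∃ k, SpineReach G k x)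
      (by
        rintro - x hx
        obtain rfl : x = cZero := by simpa [spineBase] using hx
        exact ⟨0, SpineReach.zero⟩)
      (fun E t hE ht hon => reach_invariant hG hbase hE ht hon) i (D.fb_subset_limit i)
  obtain ⟨T₁, hT₁⟩ : ⟨predReal, [cSpine, cBrake]⟩ ∈ G :=
    (hG brakeRule (mem_haltingRules.2 (by simp))).brake (hbase (by simp [spineBase]))
  have hblocked : ∀ j, (D.tr j).rule = growRule →
      ⟨predReal, [(D.tr j).map 0, cBrake]⟩ ∉ D.fb j := fun j hr hw =>
    growRule_not_applicable (hfresh j) hr (D.trig_on j (hlt j)) hw (hX j (hlt j))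
  have hstable : ∀ j ≥ T₁, ∀ x, ⟨predReal, [cSpine, x]⟩ ∈ D.fb j →
      ⟨predReal, [cSpine, x]⟩ ∈ D.fb T₁ := by
    intro j hj
    induction j, hj using Nat.le_induction with
    | base => exact fun x hx => hx
    | succ j hj ih =>
      intro x hx
      rw [D.fb_succ j (hlt j), Finset.mem_union] at hx
      rcases hx with hx | hx
      · exact ih x hx
      rcases real_mem_out (D.rule_mem j (hlt j)) (D.trig_on j (hlt j)) hx with
        ⟨hr, h0, -⟩ | ⟨-, rfl⟩ | ⟨rfl, -⟩ | ⟨rfl, -⟩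
      · exact absurd (h0 ▸ D.fb_mono hj hT₁) (hblocked j hr)
      · exact hT₁
      · refine D.fb_mono (Nat.zero_le _) ?_
        rw [D.fb_zero]
        simp [spineBase]
      · exact hT₁
  have hfin : {x | (⟨predReal, [cSpine, x]⟩ : Atom) ∈ (D.fb T₁ : Set Atom)}.Finite :=
    (D.fb T₁).finite_toSet.preimage fun x _ y _ h => by simpa using h
  obtain ⟨T₂, hT₂⟩ := D.exists_subset_fb
    (hfin.toFinset.image fun x => ⟨predReal, [x, cBrake]⟩) (by
      intro a ha
      rw [Finset.coe_image, Set.mem_image] at ha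
      obtain ⟨x, hx, rfl⟩ := ha
      have hx : ⟨predReal, [cSpine, x]⟩ ∈ D.fb T₁ := by simpa using hx
      obtain ⟨n, hn⟩ := hreach _ _ hx
      exact hG.real_brake (D.fb_subset_limit _ hx) hn (htot n))
  obtain ⟨j, hj, hnd⟩ := D.exists_not_isDatalog hlen (max T₁ T₂)
  have hr := eq_growRule_of_not_isDatalog (D.rule_mem j (hlt j)) hnd
  refine hblocked j hr ?_
  rcases howner j _ _ (growRule_isOn hr (D.trig_on j (hlt j))).1 with h | h
  · rw [h]
    exact D.fb_mono ((le_max_left _ _).trans hj) hT₁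
  · have := hstable j ((le_max_left _ _).trans hj) _ h
    exact D.fb_mono ((le_max_right _ _).trans hj)
      (hT₂ (Finset.mem_image.2 ⟨_, by simpa using this, rfl⟩))

/-! ### A model for programs that do not halt -/

/-- The term representing a natural number in the model. -/
def numElt : ℕ → Term
  | 0 => cZero
  | k + 1 => .var k

theorem numElt_injective : Function.Injective numElt := by
  rintro (_ | i) (_ | j) h <;> simp_all [numElt]

@[simp] theorem numElt_inj {i j : ℕ} : numElt i = numElt j ↔ i = j := numElt_injective.eq_iff

@[simp] theorem numElt_ne_brake (i : ℕ) : numElt i ≠ cBrake := by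
  cases i <;> simp [numElt]

@[simp] theorem brake_ne_numElt (i : ℕ) : cBrake ≠ numElt i := (numElt_ne_brake i).symm

@[simp] theorem numElt_ne_spine (i : ℕ) : numElt i ≠ cSpine := by
  cases i <;> simp [numElt]

@[simp] theorem spine_ne_numElt (i : ℕ) : cSpine ≠ numElt i := (numElt_ne_spine i).symm

/-- The atoms allowed on the spine of length `n`. -/
def SpineOk (n p : ℕ) (ts : List Term) : Prop :=
  (p = predReal → ts = [cBrake] ∨ ∃ i ≤ n, ts = [numElt i]) ∧
  (p = predEdge ∨ p = predSucc →
    (∃ a, ts = [a, cBrake]) ∨ ∃ i < n, ts = [numElt i, numElt (i + 1)])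

/-- The atoms allowed on a chain that does not reach its brake. -/
def ChainOk (e p : ℕ) (ts : List Term) : Prop :=
  (p = predEdge → (∃ a, ts = [a, cBrake]) ∨ ∃ k, ts = [numElt k, numElt (k + 1)]) ∧
  (p = predMatch → (∃ a, ts = [cBrake, a]) ∨ ∃ k, ts = [numElt k, numElt k]) ∧
  (p ≠ predEdge → p ≠ predMatch → ∃ ks : List ℕ, ts = ks.map numElt ∧ Holds e p ks)

/-- A model in which the spine has length `n` and the brake of its last element is not real. -/
def haltModel (e n : ℕ) : Set Atom :=
  {a | ∀ x ts, a.args = x :: ts →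
    (x = cSpine → SpineOk n a.pred ts) ∧ (x = numElt n → ChainOk e a.pred ts)}

section HaltModel

variable {e n : ℕ}

theorem mem_haltModel {p : ℕ} {x : Term} {ts : List Term} :
    ⟨p, x :: ts⟩ ∈ haltModel e n ↔
      (x = cSpine → SpineOk n p ts) ∧ (x = numElt n → ChainOk e p ts) := by
  simp [haltModel]

theorem mem_haltModel_spine {p : ℕ} {ts : List Term} :
    ⟨p, cSpine :: ts⟩ ∈ haltModel e n ↔ SpineOk n p ts := by
  simp [mem_haltModel]

theorem mem_haltModel_chain {p : ℕ} {ts : List Term} :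
    ⟨p, numElt n :: ts⟩ ∈ haltModel e n ↔ ChainOk e p ts := by
  simp [mem_haltModel]

theorem mem_haltModel_of_ne {p : ℕ} {x : Term} {ts : List Term} (h1 : x ≠ cSpine)
    (h2 : x ≠ numElt n) : ⟨p, x :: ts⟩ ∈ haltModel e n := by
  simp [mem_haltModel, h1, h2]

@[simp] theorem spineOk_real {a : Term} :
    SpineOk n predReal [a] ↔ a = cBrake ∨ ∃ i ≤ n, a = numElt i := by
  simp [SpineOk]

@[simp] theorem spineOk_edge {a b : Term} :
    SpineOk n predEdge [a, b] ↔ b = cBrake ∨ ∃ i < n, a = numElt i ∧ b = numElt (i + 1) := by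
  simp [SpineOk]

@[simp] theorem spineOk_succ {a b : Term} :
    SpineOk n predSucc [a, b] ↔ b = cBrake ∨ ∃ i < n, a = numElt i ∧ b = numElt (i + 1) := by
  simp [SpineOk]

theorem spineOk_of_lt {p : ℕ} {ts : List Term} (hp : predSucc < p) : SpineOk n p ts := by
  have h : 2 < p := hp
  simp [SpineOk, show p ≠ 0 by omega, show p ≠ 1 by omega, show p ≠ 2 by omega]

@[simp] theorem chainOk_edge {a b : Term} :
    ChainOk e predEdge [a, b] ↔ b = cBrake ∨ ∃ k, a = numElt k ∧ b = numElt (k + 1) := by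
  simp [ChainOk]

@[simp] theorem chainOk_match {a b : Term} :
    ChainOk e predMatch [a, b] ↔ a = cBrake ∨ ∃ k, a = numElt k ∧ b = numElt k := by
  simp [ChainOk]

theorem chainOk_iff {p : ℕ} {ts : List Term} (h1 : p ≠ predEdge) (h2 : p ≠ predMatch) :
    ChainOk e p ts ↔ ∃ ks : List ℕ, ts = ks.map numElt ∧ Holds e p ks := by
  rw [ChainOk]
  exact ⟨fun h => h.2.2 h1 h2, fun h => ⟨fun h' => absurd h' h1, fun h' => absurd h' h2,
    fun _ _ => h⟩⟩

@[simp] theorem chainOk_real {a : Term} : ChainOk e predReal [a] ↔ ∃ k, a = numElt k := by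
  rw [chainOk_iff (by decide) (by decide)]
  constructor
  · rintro ⟨ks, h, hk⟩
    obtain ⟨k, rfl⟩ := hk.1 rfl
    exact ⟨k, by simpa using h⟩
  · rintro ⟨k, rfl⟩
    exact ⟨[k], rfl, holds_real⟩

@[simp] theorem chainOk_succ {a b : Term} :
    ChainOk e predSucc [a, b] ↔ ∃ k, a = numElt k ∧ b = numElt (k + 1) := by
  rw [chainOk_iff (by decide) (by decide)]
  constructor
  · rintro ⟨ks, h, hk⟩
    obtain ⟨k, rfl⟩ := hk.2.1 rfl
    exact ⟨k, by simpa using h⟩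
  · rintro ⟨k, rfl, rfl⟩
    exact ⟨[k, k + 1], rfl, holds_succ.2 rfl⟩

theorem haltModel_grow : SatisfiesRule (haltModel e n) growRule := by
  intro σ hσ
  obtain ⟨h1, -, -⟩ : _ ∧ _ ∧ _ := by
    simpa [IsHom, growRule, Atom.subst, applyTerm] using hσ
  suffices ∃ b, ⟨predEdge, [σ 0, σ 1, b]⟩ ∈ haltModel e n ∧
      ⟨predReal, [σ 0, b]⟩ ∈ haltModel e n ∧ ⟨predEdge, [σ 0, b, cBrake]⟩ ∈ haltModel e n by
    obtain ⟨b, hb⟩ := this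
    refine ⟨Function.update σ 2 b, fun v hv => Function.update_of_ne ?_ _ _, ?_⟩
    · rintro rfl
      rw [FactBase.mem_vars] at hv
      simp [growRule] at hv
    · simpa [IsHom, growRule, Atom.subst, applyTerm] using hb
  generalize σ 0 = x at *
  generalize σ 1 = a at *
  by_cases hs : x = cSpine
  · subst hs
    simp only [mem_haltModel_spine, spineOk_real, spineOk_edge] at h1 ⊢
    rcases h1 with rfl | ⟨i, hi, rfl⟩
    · exact ⟨cBrake, by simp⟩
    · rcases hi.lt_or_eq with hi | rfl
      · exact ⟨numElt (i + 1), Or.inr ⟨i, hi, rfl, rfl⟩, Or.inr ⟨i + 1, hi, rfl⟩, Or.inl trivial⟩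
      · exact ⟨cBrake, by simp⟩
  by_cases hn : x = numElt n
  · subst hn
    simp only [mem_haltModel_chain, chainOk_real, chainOk_edge] at h1 ⊢
    obtain ⟨k, rfl⟩ := h1
    exact ⟨numElt (k + 1), Or.inr ⟨k, rfl, rfl⟩, ⟨k + 1, rfl⟩, Or.inl trivial⟩
  exact ⟨cZero, mem_haltModel_of_ne hs hn, mem_haltModel_of_ne hs hn, mem_haltModel_of_ne hs hn⟩

theorem haltModel_brake : SatisfiesRule (haltModel e n) brakeRule := by
  refine fun σ _ => ⟨σ, fun _ _ => rfl, ?_⟩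
  simp [IsHom, brakeRule, Atom.subst, applyTerm, mem_haltModel_spine]

theorem haltModel_start : SatisfiesRule (haltModel e n) startRule := by
  refine fun σ hσ => ⟨σ, fun _ _ => rfl, ?_⟩
  simp only [IsHom, startRule, Atom.subst, applyTerm, Finset.coe_insert, Finset.coe_singleton,
    Set.mem_insert_iff, Set.mem_singleton_iff, forall_eq_or_imp, forall_eq, List.map_cons,
    List.map_nil] at hσ ⊢
  rw [mem_haltModel_spine, spineOk_real] at hσ
  generalize σ 0 = x at *
  have hs : x ≠ cSpine := by
    rintro rfl
    simp at hσ
  by_cases hn : x = numElt n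
  · subst hn
    simp only [mem_haltModel_chain, chainOk_real, chainOk_edge, chainOk_match]
    exact ⟨⟨0, rfl⟩, Or.inl trivial, Or.inl trivial, Or.inr ⟨0, rfl, rfl⟩⟩
  simp only [mem_haltModel_of_ne hs hn, and_self]

theorem haltModel_succ : SatisfiesRule (haltModel e n) succRule := by
  refine fun σ hσ => ⟨σ, fun _ _ => rfl, ?_⟩
  simp only [IsHom, succRule, Atom.subst, applyTerm, Finset.coe_insert, Finset.coe_singleton,
    Set.mem_insert_iff, Set.mem_singleton_iff, forall_eq_or_imp, forall_eq, List.map_cons,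
    List.map_nil] at hσ ⊢
  generalize σ 0 = x at *
  by_cases hs : x = cSpine
  · subst hs
    simpa only [mem_haltModel_spine, spineOk_succ, spineOk_edge] using hσ.1
  by_cases hn : x = numElt n
  · subst hn
    simp only [mem_haltModel_chain, chainOk_real, chainOk_edge, chainOk_succ] at hσ ⊢
    obtain ⟨h | h, k, hk⟩ := hσ
    · simp [h] at hk
    · exact h
  exact mem_haltModel_of_ne hs hn

theorem haltModel_match : SatisfiesRule (haltModel e n) matchRule := by
  refine fun σ hσ => ⟨σ, fun _ _ => rfl, ?_⟩
  simp only [IsHom, matchRule, Atom.subst, applyTerm, Finset.coe_insert, Finset.coe_singleton,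
    Set.mem_insert_iff, Set.mem_singleton_iff, forall_eq_or_imp, forall_eq, List.map_cons,
    List.map_nil] at hσ ⊢
  generalize σ 0 = x at *
  by_cases hs : x = cSpine
  · subst hs
    exact mem_haltModel_spine.2 (spineOk_of_lt (by decide))
  by_cases hn : x = numElt n
  · subst hn
    simp only [mem_haltModel_chain, mem_haltModel_spine, spineOk_succ, chainOk_succ,
      chainOk_match] at hσ ⊢
    obtain ⟨h1, h2 | ⟨i, -, h2, h2'⟩, k, h3, h3'⟩ := hσ
    · exact Or.inl h2
    · rw [h2, h3] at h1
      simp only [numElt_ne_brake, numElt_inj, false_or] at h1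
      obtain ⟨l, rfl, rfl⟩ := h1
      exact Or.inr ⟨_, h2', h3'⟩
  exact mem_haltModel_of_ne hs hn

theorem haltModel_halt {u : Nat.Partrec.Code} (hdom : ¬ (u.eval (Nat.pair (e + 1) n)).Dom) :
    SatisfiesRule (haltModel e n) (haltRule u) := by
  refine fun σ hσ => ⟨σ, fun _ _ => rfl, ?_⟩
  simp only [IsHom, haltRule, Atom.subst, applyTerm, Finset.coe_insert, Finset.coe_singleton,
    Set.mem_insert_iff, Set.mem_singleton_iff, forall_eq_or_imp, forall_eq, List.map_cons,
    List.map_nil] at hσ ⊢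
  generalize σ 0 = x at *
  by_cases hs : x = cSpine
  · subst hs
    simp [mem_haltModel_spine]
  by_cases hn : x = numElt n
  · subst hn
    simp only [mem_haltModel_chain, chainOk_match] at hσ
    obtain ⟨-, h2, h3, h4, h5⟩ := hσ
    simp only [numElt_ne_brake, numElt_inj, false_or] at h2
    rw [chainOk_iff (by decide) (by decide)] at h3 h4
    rw [chainOk_iff (predEval_ne (show 1 < 7 by omega) u).symm
      (predEval_ne (show 3 < 7 by omega) u).symm] at h5
    obtain ⟨k, rfl, h2⟩ := h2
    obtain ⟨ks, h3, h3'⟩ := h3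
    obtain rfl := h3'.2.2.2.2.1 rfl
    obtain ⟨ls, h4, h4'⟩ := h4
    obtain ⟨a, b, rfl⟩ := h4'.2.2.2.1 rfl
    obtain ⟨ms, h5, h5'⟩ := h5
    obtain ⟨c, d, rfl, hd⟩ := h5'.2.2.2.2.2 u rfl
    simp only [List.map_cons, List.map_nil, List.cons.injEq, and_true] at h3 h4 h5
    obtain rfl : e + 1 = a := by simpa [h3] using h4.1
    obtain rfl : n = b := by simpa [h2] using h4.2.1
    obtain rfl : Nat.pair (e + 1) n = c := by simpa [h4.2.2] using h5.1
    exact absurd (Part.dom_iff_mem.2 ⟨d, hd⟩) hdom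
  exact mem_haltModel_of_ne hs hn

theorem haltModel_clause {C : Clause} (hC : C.Good) (hsat : C.Sat (Holds e)) :
    SatisfiesRule (haltModel e n) C.toRule := by
  refine fun σ hσ => ⟨σ, fun _ _ => rfl, ?_⟩
  obtain ⟨hsafe, hbody, hhead⟩ := hC
  have key : ∀ b : NumAtom, (ownedAtom b).subst σ =
      ⟨b.1, σ 0 :: b.2.map fun o => applyTerm σ (numTerm o)⟩ := by
    intro b
    simp only [ownedAtom, Atom.subst, List.map_cons, List.map_map, applyTerm]
    rfl
  suffices (ownedAtom C.head).subst σ ∈ haltModel e n by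
    simpa [IsHom, Clause.toRule] using this
  have hσ : ∀ b ∈ C.body, (ownedAtom b).subst σ ∈ haltModel e n := fun b hb =>
    hσ _ (Clause.mem_toRule_body.2 (Or.inr ⟨b, hb, rfl⟩))
  simp only [key] at hσ ⊢
  generalize σ 0 = x at *
  by_cases hs : x = cSpine
  · subst hs
    exact mem_haltModel_spine.2 (spineOk_of_lt (lt_trans (by decide) hhead))
  by_cases hn : x = numElt n
  · subst hn
    set ρ : ℕ → ℕ := fun i => Function.invFun numElt (σ (i + 1)) with hρ
    have hval : ∀ o k, applyTerm σ (numTerm o) = numElt k → numVal ρ o = k := by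
      rintro (_ | i) k hk
      · exact numElt_injective hk
      · simp only [numTerm, applyTerm] at hk
        simp [numVal, hρ, hk, Function.leftInverse_invFun numElt_injective k]
    have hcode : ∀ b ∈ C.body, (∀ o ∈ b.2, applyTerm σ (numTerm o) = numElt (numVal ρ o)) ∧
        Holds e b.1 (b.2.map (numVal ρ)) := by
      intro b hb
      have h := hσ b hb
      rw [mem_haltModel_chain, chainOk_iff (hbody b hb).1 (hbody b hb).2] at h
      obtain ⟨ks, hks, hH⟩ := h
      have h1 : ∀ o ∈ b.2, applyTerm σ (numTerm o) = numElt (numVal ρ o) := by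
        intro o ho
        have : applyTerm σ (numTerm o) ∈ ks.map numElt := hks ▸ List.mem_map.2 ⟨o, ho, rfl⟩
        obtain ⟨k, -, hk⟩ := List.mem_map.1 this
        rw [hval o k hk.symm, hk]
      refine ⟨h1, ?_⟩
      rw [List.map_congr_left h1, ← Function.comp_def, ← List.map_map] at hks
      rwa [List.map_injective_iff.2 numElt_injective hks]
    rw [mem_haltModel_chain, chainOk_iff (lt_trans (by decide) hhead).ne' hhead.ne']
    refine ⟨C.head.2.map (numVal ρ), ?_, hsat ρ fun b hb => (hcode b hb).2⟩
    rw [List.map_map]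
    refine List.map_congr_left fun o ho => ?_
    cases o with
    | none => rfl
    | some i =>
      obtain ⟨b, hb, hib⟩ := hsafe i ho
      exact (hcode b hb).1 _ hib
  exact mem_haltModel_of_ne hs hn

/-- The model satisfies all rules if the simulated program does not halt on `n`. -/
theorem isModelOfRules_haltModel {u : Nat.Partrec.Code}
    (hdom : ¬ (u.eval (Nat.pair (e + 1) n)).Dom) :
    IsModelOfRules (haltingRules u e) (haltModel e n) := by
  intro R hR
  rcases mem_haltingRules.1 hR with (rfl | rfl | rfl | rfl | rfl | rfl) | ⟨C, hC, rfl⟩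
  · exact haltModel_grow
  · exact haltModel_brake
  · exact haltModel_start
  · exact haltModel_succ
  · exact haltModel_match
  · exact haltModel_halt hdom
  · exact haltModel_clause (simClauses_good C hC) (simClauses_sat C hC)

end HaltModel

/-! ### Infinite fair derivations for programs that do not halt -/

/-- The trigger extending the spine after the element `b`. -/
def spineTrigger (b : Term) : Trigger := ⟨growRule, listSubst [cSpine, b]⟩

/-- The elements of the spine. -/
def spineElt : ℕ → Term
  | 0 => cZero
  | k + 1 => .var ((spineTrigger (spineElt k)).freshVar 2)

/-- The factbase whose spine has length `k`. -/
def spineFb : ℕ → FactBase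
  | 0 => spineBase
  | k + 1 => spineFb k ∪ (spineTrigger (spineElt k)).out

theorem spineTrigger_out (k : ℕ) : (spineTrigger (spineElt k)).out =
    {⟨predEdge, [cSpine, spineElt k, spineElt (k + 1)]⟩, ⟨predReal, [cSpine, spineElt (k + 1)]⟩,
      ⟨predEdge, [cSpine, spineElt (k + 1), cBrake]⟩} :=
  growRule_out rfl

theorem spineElt_injective : Function.Injective spineElt := by
  have key : ∀ i j, spineElt i = spineElt j → i = j := by
    intro i
    induction i with
    | zero =>
      rintro (_ | j) h
      · rfl
      · simp [spineElt] at h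
    | succ i ih =>
      rintro (_ | j) h
      · simp [spineElt] at h
      · simp only [spineElt, Term.var.injEq, Trigger.freshVar_eq, Nat.pair_eq_pair, and_true] at h
        exact congr_arg _ (ih j ((Trigger.code_eq_iff.1 h).2 1
          (FactBase.mem_vars.2 ⟨⟨predReal, [.var 0, .var 1]⟩, by simp [spineTrigger, growRule]⟩)))
  exact fun i j => key i j

theorem applyTerm_const (σ : Subst) (c : ℕ) : applyTerm σ (.const c) = .const c := rfl

theorem spineElt_ne_brake (k : ℕ) : spineElt k ≠ cBrake := by
  cases k <;> simp [spineElt]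

theorem mem_spineFb {k : ℕ} {a : Atom} : a ∈ spineFb k ↔
    a = ⟨predEdge, [cSpine, cBrake, cBrake]⟩ ∨
      (∃ j ≤ k, a = ⟨predReal, [cSpine, spineElt j]⟩) ∨
      (∃ j ≤ k, a = ⟨predEdge, [cSpine, spineElt j, cBrake]⟩) ∨
      ∃ j < k, a = ⟨predEdge, [cSpine, spineElt j, spineElt (j + 1)]⟩ := by
  induction k with
  | zero =>
    simp [spineFb, spineBase, spineElt]
    tauto
  | succ k ih =>
    rw [spineFb, Finset.mem_union, ih, spineTrigger_out]
    simp only [Finset.mem_insert, Finset.mem_singleton, Nat.le_succ_iff_eq_or_le,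
      Nat.lt_succ_iff_lt_or_eq, or_and_right, exists_or, exists_eq_left,
      Nat.succ_eq_add_one]
    exact iff_of_eq (by ac_rfl)

theorem freshInv_spineFb (k : ℕ) : FreshInv (spineFb k) ∧
    (spineTrigger (spineElt k)).IsOn (spineFb k) := by
  induction k with
  | zero =>
    refine ⟨freshInv_spineBase, ?_⟩
    simp [Trigger.IsOn, IsHom, spineTrigger, growRule, listSubst, Atom.subst, applyTerm, spineFb,
      spineBase, spineElt]
  | succ k ih =>
    refine ⟨ih.1.union_out ih.2, ?_⟩
    simp [Trigger.IsOn, IsHom, spineTrigger, growRule, listSubst, Atom.subst, applyTerm,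
      mem_spineFb, spineElt_injective.eq_iff]

theorem spineTrigger_applicable (k : ℕ) :
    Applicable .R (spineTrigger (spineElt k)) (spineFb k) := by
  by_contra hcon
  obtain ⟨σ, hσ, hhead⟩ := exists_head_hom_of_not_applicable (freshInv_spineFb k).2 hcon
  have h0 : σ 0 = cSpine := hσ 0
    (FactBase.mem_vars.2 ⟨⟨predReal, [.var 0, .var 1]⟩, by simp [spineTrigger, growRule]⟩)
  have h1 : σ 1 = spineElt k := hσ 1
    (FactBase.mem_vars.2 ⟨⟨predReal, [.var 0, .var 1]⟩, by simp [spineTrigger, growRule]⟩)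
  simp only [IsHom, spineTrigger, growRule, Finset.coe_insert, Finset.coe_singleton,
    Set.mem_insert_iff, Set.mem_singleton_iff, forall_eq_or_imp, forall_eq, Atom.subst, applyTerm,
    List.map_cons, List.map_nil, h0, h1, Finset.mem_coe, mem_spineFb] at hhead
  obtain ⟨hedge, hreal, -⟩ := hhead
  obtain ⟨j, -, hj⟩ : ∃ j ≤ k, σ 2 = spineElt j := by simpa using hreal
  rw [hj] at hedge
  simp only [Atom.mk.injEq, List.cons.injEq, true_and, and_true, spineElt_ne_brake, and_false,
    false_or, exists_false, reduceCtorEq, spineElt_injective.eq_iff] at hedge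
  obtain ⟨i, hi, rfl, -⟩ := hedge
  exact lt_irrefl _ hi

/-- The invariant of the derivations that do not reach the brake of the chain of the last
element of the spine. -/
def RunInv (e n : ℕ) (E : FactBase) : Prop :=
  FreshInv E ∧ ⟨predReal, [cSpine, spineElt n]⟩ ∈ E ∧
    ∃ h : Subst, IsHom h ↑E (haltModel e n) ∧ applyTerm h (spineElt n) = numElt n

theorem runInv_spineFb (e n : ℕ) : RunInv e n (spineFb n) := by
  set h : Subst := fun v => numElt (Function.invFun spineElt (.var v)) with hh
  have hval : ∀ j, applyTerm h (spineElt j) = numElt j := by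
    intro j
    cases j with
    | zero => rfl
    | succ j =>
      exact congr_arg numElt (Function.leftInverse_invFun spineElt_injective (j + 1))
  refine ⟨(freshInv_spineFb n).1, by simp [mem_spineFb, spineElt_injective.eq_iff], h,
    fun a ha => ?_, hval n⟩
  rcases mem_spineFb.1 ha with rfl | ⟨j, hj, rfl⟩ | ⟨j, hj, rfl⟩ | ⟨j, hj, rfl⟩
  all_goals
    simp only [Atom.subst, List.map_cons, List.map_nil, hval, applyTerm_const, mem_haltModel_spine,
      spineOk_real, spineOk_edge]
  · exact Or.inl trivial
  · exact Or.inr ⟨j, hj, rfl⟩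
  · exact Or.inl trivial
  · exact Or.inr ⟨j, hj, rfl, rfl⟩

section RunInv

variable {e n : ℕ} {u : Nat.Partrec.Code} {E : FactBase}

theorem RunInv.union_out (hdom : ¬ (u.eval (Nat.pair (e + 1) n)).Dom) (hE : RunInv e n E)
    {t : Trigger} (ht : t.rule ∈ haltingRules u e) (hon : t.IsOn E) :
    RunInv e n (E ∪ t.out) := by
  obtain ⟨hfresh, hlast, h, hh, hn⟩ := hE
  obtain ⟨h', hagree, hh'⟩ :=
    hfresh.exists_hom_extension hon (isModelOfRules_haltModel hdom _ ht) hh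
  refine ⟨hfresh.union_out hon, Finset.mem_union_left _ hlast, h', hh', ?_⟩
  have := Atom.subst_congr (a := ⟨predReal, [cSpine, spineElt n]⟩) (σ := h') (τ := h)
    fun v hv => hagree v (FactBase.mem_vars.2 ⟨_, hlast, hv⟩)
  rw [← hn]
  simpa [Atom.subst, applyTerm_const] using this

theorem RunInv.exists_active (hE : RunInv e n E) : ∃ t, Active (haltingRules u e) E t := by
  obtain ⟨hfresh, hlast, h, hh, hn⟩ := hE
  by_contra hcon
  push Not at hcon
  have hmodel : IsModelOfRules (haltingRules u e) (E : Set Atom) := fun R hR σ hσ =>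
    exists_head_hom_of_not_applicable (t := ⟨R, σ⟩) hσ fun happ => hcon ⟨R, σ⟩ ⟨hR, hσ, happ⟩
  obtain ⟨h1, h2, h3, -⟩ := (hmodel startRule (mem_haltingRules.2 (by simp))).start hlast
  obtain ⟨a, ha0, ha⟩ :=
    (hmodel growRule (mem_haltingRules.2 (by simp))).exists_chain h1 h2 h3
  have hval : ∀ k, applyTerm h (a k) = numElt k := by
    intro k
    induction k with
    | zero => rw [ha0]; rfl
    | succ k ih =>
      have hreal := hh _ (ha (k + 1)).1
      have hedge := hh _ (ha k).2
      simp only [Atom.subst, List.map_cons, List.map_nil, hn, ih, mem_haltModel_chain,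
        chainOk_real, chainOk_edge, numElt_inj] at hreal hedge
      obtain ⟨j, hj⟩ := hreal
      rw [hj] at hedge ⊢
      simp only [numElt_ne_brake, false_or] at hedge
      obtain ⟨i, rfl, hi⟩ := hedge
      exact hi
  have hinj : Function.Injective fun k => (⟨predReal, [spineElt n, a k]⟩ : Atom) := by
    intro i j hij
    have hij : a i = a j := by simpa using hij
    exact numElt_injective (by rw [← hval i, ← hval j, hij])
  exact Set.infinite_of_injective_forall_mem hinj (fun k => (ha k).1) E.finite_toSet

end RunInv

/-- If the simulated program does not halt on some input, then there is an infinite fair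
R-derivation. -/
theorem exists_infinite_of_not_dom {u : Nat.Partrec.Code} {e n : ℕ}
    (hdom : ¬ (u.eval (Nat.pair (e + 1) n)).Dom) :
    ∃ D : Derivation (haltingRules u e) spineBase, D.IsX .R ∧ D.Fair .R ∧ ¬ D.Finite :=
  exists_infinite_fair n spineFb (fun k => spineTrigger (spineElt k))
    (fun k _ => ⟨mem_haltingRules.2 (Or.inl (Or.inl rfl)), (freshInv_spineFb k).2,
      spineTrigger_applicable k⟩)
    (fun _ _ => rfl) (RunInv e n) (runInv_spineFb e n) (fun _ hE => hE.exists_active)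
    fun _ _ hE ht => hE.union_out hdom ht.1 ht.2.1

/-! ### Computability of the rule set -/

section Codes

open Encodable

theorem encode_list_map_encode {α : Type*} [Encodable α] (l : List α) :
    encode (l.map encode) = encode l := by
  induction l with
  | nil => rfl
  | cons a l ih => rw [List.map_cons, encode_list_cons, encode_list_cons, ih, encode_nat]

/-- The order instances are implicit because the order used by `Multiset.encodable` is private. -/
theorem exists_list_of_eq_sort {α : Type*} [Encodable α] {s : Multiset α} {n : ℕ}
    {r : α → α → Prop} {_ : DecidableRel r} {_ : IsTrans α r} {_ : Std.Antisymm r}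
    {_ : Std.Total r} (h : n = encode (s.sort r)) (hr : ∀ a b, r a b → encode a ≤ encode b) :
    ∃ l : List α, n = encode l ∧ (l : Multiset α) = s ∧
      l.Pairwise fun a b => encode a ≤ encode b :=
  ⟨_, h, s.sort_eq r, (s.pairwise_sort r).imp fun h => hr _ _ h⟩

/-- A finite set is encoded through its list of elements in increasing order of codes. -/
theorem exists_encode_finset_eq {α : Type*} [Encodable α] (s : Finset α) :
    ∃ l : List α, encode s = encode l ∧ (∀ a, a ∈ s ↔ a ∈ l) ∧
      l.Pairwise fun a b => encode a < encode b := by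
  obtain ⟨l, hl, hs, hsort⟩ : ∃ l : List α, encode s = encode l ∧
      (l : Multiset α) = s.val ∧ l.Pairwise fun a b => encode a ≤ encode b := by
    have h : encode s = encodeMultiset s.val := rfl
    unfold encodeMultiset at h
    exact exists_list_of_eq_sort h fun _ _ hab => hab
  refine ⟨l, hl, fun a => by rw [← Finset.mem_val, ← hs, Multiset.mem_coe], ?_⟩
  have hnodup : l.Nodup := by
    rw [← Multiset.coe_nodup, hs]
    exact s.nodup
  exact hsort.imp₂ (fun a b hab hne => lt_of_le_of_ne hab fun h => hne (encode_injective h)) hnodup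

/-- The code of a finite set is the code of its strictly increasing list of codes. -/
theorem encode_finset_eq {α : Type*} [Encodable α] {s : Finset α} {l : List α}
    (hs : ∀ a, a ∈ s ↔ a ∈ l) (hl : l.Pairwise fun a b => encode a < encode b) :
    encode s = encode (l.map encode) := by
  obtain ⟨m, hm, hms, hsort⟩ := exists_encode_finset_eq s
  have hnodup : ∀ {l : List α}, (l.Pairwise fun a b => encode a < encode b) → l.Nodup :=
    fun h => h.imp fun h hab => h.ne (congrArg encode hab)
  have hperm : m.Perm l := (List.perm_ext_iff_of_nodup (hnodup hsort) (hnodup hl)).2 fun a =>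
    (hms a).symm.trans (hs a)
  rw [hm, encode_list_map_encode]
  congr 1
  exact hperm.eq_of_pairwise (fun a b _ _ hab hba => absurd hab hba.asymm) hsort hl

/-- Insertion of a number into a strictly increasing list of numbers. -/
def insertCode (L : List ℕ) (x : ℕ) : List ℕ :=
  L.filter (fun y => decide (y < x)) ++ x :: L.filter (fun y => decide (x < y))

theorem primrec_filter_const {p : ℕ → ℕ → Prop} [DecidableRel p] (hp : PrimrecRel p) (L : List ℕ) :
    Primrec fun x => L.filter fun y => decide (p y x) := by
  induction L with
  | nil => exact Primrec.const []
  | cons a L ih =>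
    refine (Primrec.ite (hp.comp (Primrec.const a) Primrec.id)
      (Primrec.list_cons.comp (Primrec.const a) ih) ih).of_eq fun x => ?_
    by_cases h : p a x <;> simp [h]

theorem primrec_insertCode (L : List ℕ) : Primrec (insertCode L) :=
  Primrec.list_append.comp (primrec_filter_const Primrec.nat_lt L)
    (Primrec.list_cons.comp Primrec.id
      (primrec_filter_const (p := fun y x => x < y) Primrec.nat_lt.swap L))

theorem exists_encode_insert {α : Type*} [Encodable α] [DecidableEq α] (s : Finset α) :
    ∃ L : List ℕ, ∀ a, encode (insert a s) = encode (insertCode L (encode a)) := by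
  obtain ⟨l, -, hs, hl⟩ := exists_encode_finset_eq s
  refine ⟨l.map encode, fun a => ?_⟩
  rw [encode_finset_eq (l := l.filter (fun y => decide (encode y < encode a)) ++
      a :: l.filter (fun y => decide (encode a < encode y)))]
  · simp [insertCode, List.filter_map, Function.comp_def]
  · intro x
    have := lt_trichotomy (encode x) (encode a)
    rw [encode_inj] at this
    simp only [Finset.mem_insert, List.mem_append, List.mem_cons, List.mem_filter,
      decide_eq_true_eq, hs]
    tauto
  · simp only [List.pairwise_append, List.pairwise_cons, List.mem_filter, decide_eq_true_eq,
      List.mem_cons]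
    refine ⟨hl.filter _, ⟨fun x hx => hx.2, hl.filter _⟩, ?_⟩
    rintro x ⟨-, hx⟩ y (rfl | ⟨-, hy⟩)
    exacts [hx, hx.trans hy]

theorem encode_rule (R : Rule) : encode R = Nat.pair (encode R.body) (encode R.head) := rfl

theorem encode_atom (p : ℕ) (ts : List Term) : encode (⟨p, ts⟩ : Atom) = Nat.pair p (encode ts) :=
  rfl

theorem encode_const (n : ℕ) : encode (Term.const n) = 2 * n := rfl

theorem encode_var (n : ℕ) : encode (Term.var n) = 2 * n + 1 := rfl

/-- The code of an atom stating that one number variable is the successor of another. -/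
def succCode (i : ℕ) : ℕ := encode (ownedAtom (predSucc, [some i, some (i + 1)]))

theorem succCode_eq (i : ℕ) : succCode i =
    Nat.pair 2 (Nat.pair 1 (Nat.pair (2 * i + 3) (Nat.pair (2 * i + 5) 0 + 1) + 1) + 1) := by
  simp only [succCode, ownedAtom, encode_atom, List.map_cons, List.map_nil, encode_list_cons,
    encode_list_nil, numTerm, encode_var, predSucc]
  rfl

theorem strictMono_succCode : StrictMono succCode := by
  intro i j h
  rw [succCode_eq, succCode_eq]
  have h1 : Nat.pair (2 * i + 5) 0 < Nat.pair (2 * j + 5) 0 := Nat.pair_lt_pair_left _ (by omega)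
  exact Nat.pair_lt_pair_right _ (Nat.succ_lt_succ (Nat.pair_lt_pair_right _ (Nat.succ_lt_succ
    ((Nat.pair_lt_pair_left _ (by omega)).trans (Nat.pair_lt_pair_right _ (Nat.succ_lt_succ h1))))))

theorem primrec_succCode : Primrec succCode := by
  have hlin : ∀ k, Primrec fun i : ℕ => 2 * i + k := fun k =>
    Primrec.nat_add.comp (Primrec.nat_mul.comp (Primrec.const 2) Primrec.id) (Primrec.const k)
  have hpair : ∀ {f g : ℕ → ℕ}, Primrec f → Primrec g → Primrec fun i => Nat.pair (f i) (g i) + 1 :=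
    fun hf hg => Primrec.succ.comp (Primrec₂.natPair.comp hf hg)
  exact (Primrec₂.natPair.comp (Primrec.const 2) (hpair (Primrec.const 1)
    (hpair (hlin 3) (hpair (hlin 5) (Primrec.const 0))))).of_eq fun i => (succCode_eq i).symm

/-- The code of the atom stating that an element is real. -/
def realCode : ℕ := encode (⟨predReal, [.var 0, cZero]⟩ : Atom)

/-- The code of the atom stating that a number variable is the successor of zero. -/
def succZeroCode : ℕ := encode (ownedAtom (predSucc, [none, some 0]))

theorem realCode_lt : realCode < succZeroCode := by
  simp [realCode, succZeroCode, ownedAtom, encode_atom, encode_list_cons, encode_list_nil, numTerm,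
    encode_var, encode_const, cZero, predReal, predSucc, Nat.pair]

theorem succZeroCode_lt (i : ℕ) : succZeroCode < succCode i := by
  refine lt_of_lt_of_le ?_ (strictMono_succCode.monotone (Nat.zero_le i))
  simp [succCode, succZeroCode, ownedAtom, encode_atom, encode_list_cons, encode_list_nil, numTerm,
    encode_var, encode_const, cZero, predSucc, Nat.pair]

theorem encode_progClause_body (e : ℕ) : encode (progClause e).toRule.body =
    encode (realCode :: succZeroCode :: (List.range e).map succCode) := by
  rw [encode_finset_eq (l := ⟨predReal, [.var 0, cZero]⟩ :: ownedAtom (predSucc, [none, some 0]) ::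
    (List.range e).map fun i => ownedAtom (predSucc, [some i, some (i + 1)]))
    (fun a => by simp [Clause.toRule, progClause])]
  · simp only [List.map_cons, List.map_map]
    rfl
  · simp only [List.pairwise_cons, List.mem_cons, List.mem_map, List.pairwise_map]
    refine ⟨?_, ?_, List.pairwise_lt_range.imp fun h => strictMono_succCode h⟩
    · rintro a (rfl | ⟨i, -, rfl⟩)
      exacts [realCode_lt, realCode_lt.trans (succZeroCode_lt i)]
    · rintro a ⟨i, -, rfl⟩
      exact succZeroCode_lt i

theorem encode_progClause_head (e : ℕ) : encode (progClause e).toRule.head =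
    Nat.pair (Nat.pair 6 (Nat.pair 1 (Nat.pair (2 * e + 3) 0 + 1) + 1)) 0 + 1 := by
  rw [encode_finset_eq (l := [ownedAtom (predProg, [some e])])
    (fun a => by simp [Clause.toRule, progClause]) (List.pairwise_singleton _ _)]
  simp only [ownedAtom, encode_atom, List.map_cons, List.map_nil, encode_list_cons,
    encode_list_nil, numTerm, encode_var, predProg, encode_nat]
  rfl

theorem primrec_encode_progRule : Primrec fun e => encode (progClause e).toRule := by
  have hpair : ∀ {f g : ℕ → ℕ}, Primrec f → Primrec g → Primrec fun i => Nat.pair (f i) (g i) + 1 :=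
    fun hf hg => Primrec.succ.comp (Primrec₂.natPair.comp hf hg)
  have hbody : Primrec fun e => encode (progClause e).toRule.body :=
    (Primrec.encode.comp (Primrec.list_cons.comp (Primrec.const realCode)
      (Primrec.list_cons.comp (Primrec.const succZeroCode)
        (Primrec.list_map Primrec.list_range
          (primrec_succCode.comp Primrec.snd).to₂)))).of_eq fun e =>
      (encode_progClause_body e).symm
  have hhead : Primrec fun e => encode (progClause e).toRule.head := by
    refine (hpair (Primrec₂.natPair.comp (Primrec.const 6) (hpair (Primrec.const 1)
      (hpair (f := fun e => 2 * e + 3) ?_ (Primrec.const 0)))) (Primrec.const 0)).of_eq fun e =>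
        (encode_progClause_head e).symm
    exact Primrec.nat_add.comp (Primrec.nat_mul.comp (Primrec.const 2) Primrec.id)
      (Primrec.const 3)
  exact (Primrec₂.natPair.comp hbody hhead).of_eq fun e => (encode_rule _).symm

theorem primrec_encode_haltingRules (u : Nat.Partrec.Code) :
    Primrec fun e => encode (haltingRules u e) := by
  obtain ⟨L, hL⟩ := exists_encode_insert (simRules u)
  refine (Primrec.encode.comp ((primrec_insertCode L).comp primrec_encode_progRule)).of_eq
    fun e => (hL _).symm

end Codes

/-- A universal program, taking a pair of the successor of a program code and an input. -/
theorem exists_universal_code : ∃ u : Nat.Partrec.Code, ∀ (c : Nat.Partrec.Code) (n : ℕ),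
    u.eval (Nat.pair (Encodable.encode c + 1) n) = c.eval n := by
  have hcomp : Computable fun m : ℕ => Denumerable.ofNat Nat.Partrec.Code (m.unpair.1 - 1) :=
    ((Primrec.ofNat Nat.Partrec.Code).comp (Primrec.nat_sub.comp
      (Primrec.fst.comp Primrec.unpair) (Primrec.const 1))).to_comp
  have hpart : Partrec fun m : ℕ =>
      (Denumerable.ofNat Nat.Partrec.Code (m.unpair.1 - 1)).eval m.unpair.2 :=
    Nat.Partrec.Code.eval_part.comp hcomp
      (Computable.snd.comp Primrec.unpair.to_comp)
  obtain ⟨u, hu⟩ := Nat.Partrec.Code.exists_code.1 (Partrec.nat_iff.1 hpart)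
  exact ⟨u, fun c n => by simp [hu]⟩

/-- **Statement 17.** There is a factbase `F` such that the set of rule sets whose
fair R-derivations from `⟨𝓡, F⟩` are all finite is `Π⁰₂`-hard: the (`Π⁰₂`-complete)
set of programs halting on every input many-one reduces to it via a total
computable function. -/
theorem statement18 :
    ∃ F : FactBase, ∃ g : Nat.Partrec.Code → RuleSet,
      Computable (fun c => Encodable.encode (g c)) ∧
      ∀ c : Nat.Partrec.Code,
        (∀ n : ℕ, (c.eval n).Dom) ↔
          (∀ D : Derivation (g c) F, D.IsX Variant.R → D.Fair Variant.R → D.Finite) := by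
  obtain ⟨u, hu⟩ := exists_universal_code
  refine ⟨spineBase, fun c => haltingRules u (Encodable.encode c),
    ((primrec_encode_haltingRules u).comp Primrec.encode).to_comp, fun c => ⟨fun htot D hX hfair =>
      finite_of_total (fun n => (hu c n).symm ▸ htot n) D hX hfair, fun hfin n => ?_⟩⟩
  by_contra hdom
  rw [← hu c n] at hdom
  obtain ⟨D, hX, hfair, hinf⟩ := exists_infinite_of_not_dom hdom
  exact hinf (hfin D hX hfair)

end
end ExRules
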